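/- Suppose the high temperature condition holds with parameters q ∈ [0,1) and K > 0. Then there exists a constant C depending only on β, h, K such that for every N ≥ 2 for which the high temperature condition holds and every 1 ≤ i ≤ N, E( ⟨σ_i⟩ - tanh( (β/√N) Σ_{j≠i} g_{ij} ⟨σ_j⟩ + h - β²(1-q)⟨σ_i⟩ ) )² ≤ C/√N. (These are the Thouless–Anderson–Palmer equations with quantitative error.) -/

import Mathlib

open MeasureTheory ProbabilityTheory Real Finset

namespace SK

/-- Index set of pairs `i < j` in `Fin N`. -/
abbrev Pairs (N : ℕ) := {p : Fin N × Fin N // p.1 < p.2}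

/-- The disorder: one real coordinate per pair. -/
abbrev Disorder (N : ℕ) := Pairs N → ℝ

/-- Law of the disorder: i.i.d. standard Gaussians. -/
noncomputable def μdis (N : ℕ) : Measure (Disorder N) :=
  Measure.pi fun _ => gaussianReal 0 1

/-- The symmetric extension `g_{ij}` of the disorder. -/
noncomputable def gval {N : ℕ} (G : Disorder N) (i j : Fin N) : ℝ :=
  if hij : i < j then G ⟨(i, j), hij⟩ else if hji : j < i then G ⟨(j, i), hji⟩ else 0

abbrev Config (N : ℕ) := Fin N → Bool

/-- Spins `±1`. -/
def spin (b : Bool) : ℝ := if b then 1 else -1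

/-- (Negative) Hamiltonian of the SK model. -/
noncomputable def ham {N : ℕ} (β h : ℝ) (G : Disorder N) (σ : Config N) : ℝ :=
  (β / Real.sqrt N) * ∑ p : Pairs N, G p * spin (σ p.1.1) * spin (σ p.1.2)
    + h * ∑ i, spin (σ i)

/-- Partition function. -/
noncomputable def Zpart {N : ℕ} (β h : ℝ) (G : Disorder N) : ℝ :=
  ∑ σ : Config N, Real.exp (ham β h G σ)

/-- Gibbs measure. -/
noncomputable def gibbs {N : ℕ} (β h : ℝ) (G : Disorder N) (σ : Config N) : ℝ :=
  Real.exp (ham β h G σ) / Zpart β h G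

/-- Quenched average of a function of one replica. -/
noncomputable def qavg {N : ℕ} (β h : ℝ) (G : Disorder N) (f : Config N → ℝ) : ℝ :=
  ∑ σ : Config N, f σ * gibbs β h G σ

/-- Quenched average of a function of two replicas. -/
noncomputable def qavg2 {N : ℕ} (β h : ℝ) (G : Disorder N)
    (f : Config N → Config N → ℝ) : ℝ :=
  ∑ σ1 : Config N, ∑ σ2 : Config N, f σ1 σ2 * gibbs β h G σ1 * gibbs β h G σ2

/-- Overlap of two configurations. -/
noncomputable def overlap {N : ℕ} (σ1 σ2 : Config N) : ℝ :=
  (1 / (N : ℝ)) * ∑ i, spin (σ1 i) * spin (σ2 i)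

/-- The high temperature condition `E⟨(R₁₂ - q)⁴⟩ ≤ K/N²`. -/
def highTemp (N : ℕ) (β h q K : ℝ) : Prop :=
  ∫ G, qavg2 β h G (fun σ1 σ2 => (overlap σ1 σ2 - q) ^ 4) ∂(μdis N) ≤ K / (N : ℝ) ^ 2

/-- Magnetization `⟨σ_i⟩`. -/
noncomputable def mavg {N : ℕ} (β h : ℝ) (G : Disorder N) (i : Fin N) : ℝ :=
  qavg β h G fun σ => spin (σ i)

/-- Local field `ℓ_i`. -/
noncomputable def locField {N : ℕ} (G : Disorder N) (i : Fin N) (σ : Config N) : ℝ :=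
  (1 / Real.sqrt N) * ∑ j ∈ Finset.univ.erase i, gval G i j * spin (σ j)

/-- The field `r_i`. -/
noncomputable def rfield {N : ℕ} (β h q : ℝ) (G : Disorder N) (i : Fin N) : ℝ :=
  (1 / Real.sqrt N) * ∑ j ∈ Finset.univ.erase i, gval G i j * mavg β h G j
    - β * (1 - q) * mavg β h G i

/-- Gaussian density `φ_{μ,v}` with mean `μ` and variance `v`. -/
noncomputable def gaussDens (μ v x : ℝ) : ℝ :=
  (1 / (Real.sqrt (2 * π) * Real.sqrt v)) * Real.exp (-(x - μ) ^ 2 / (2 * v))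

/-- Mixture-Gaussian density `ψ_{a,b,μ,v}`. -/
noncomputable def mixDens (a b μ v x : ℝ) : ℝ :=
  Real.cosh (a * x + b) * Real.exp (-(x - μ) ^ 2 / (2 * v)) /
    (Real.sqrt (2 * π) * Real.sqrt v * Real.cosh (a * μ + b) * Real.exp (a ^ 2 * v / 2))

section GaussianMoments

lemma mem_interior_integrableExpSet_gaussianReal (t : ℝ) :
    t ∈ interior (integrableExpSet id (gaussianReal 0 1)) := by
  have : integrableExpSet id (gaussianReal 0 1) = Set.univ := by
    ext s
    simpa [integrableExpSet] using integrable_exp_mul_gaussianReal (μ := 0) (v := 1) s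
  simp [this]

lemma integrable_pow_mul_exp_gaussianReal (n : ℕ) (t : ℝ) :
    Integrable (fun x : ℝ => x ^ n * Real.exp (t * x)) (gaussianReal 0 1) :=
  integrable_pow_mul_exp_of_mem_interior_integrableExpSet
    (mem_interior_integrableExpSet_gaussianReal t) n

lemma integral_pow_mul_exp_gaussianReal (n : ℕ) (t : ℝ) :
    ∫ x : ℝ, x ^ n * Real.exp (t * x) ∂(gaussianReal 0 1)
      = iteratedDeriv n (fun s : ℝ => Real.exp (s ^ 2 / 2)) t := by
  have h := iteratedDeriv_mgf (mem_interior_integrableExpSet_gaussianReal t) n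
  rw [mgf_id_gaussianReal] at h
  simpa using h.symm

lemma hasDerivAt_exp_sq_div_two (t : ℝ) :
    HasDerivAt (fun s : ℝ => Real.exp (s ^ 2 / 2)) (t * Real.exp (t ^ 2 / 2)) t := by
  have h := ((hasDerivAt_pow 2 t).div_const 2).exp
  convert h using 1
  push_cast
  ring

lemma integral_exp_gaussianReal (t : ℝ) :
    ∫ x : ℝ, Real.exp (t * x) ∂(gaussianReal 0 1) = Real.exp (t ^ 2 / 2) := by
  simpa using integral_pow_mul_exp_gaussianReal 0 t

lemma integral_mul_exp_gaussianReal (t : ℝ) :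
    ∫ x : ℝ, x * Real.exp (t * x) ∂(gaussianReal 0 1) = t * Real.exp (t ^ 2 / 2) := by
  have h := integral_pow_mul_exp_gaussianReal 1 t
  rw [iteratedDeriv_one, (hasDerivAt_exp_sq_div_two t).deriv] at h
  simpa using h

lemma integral_sq_mul_exp_gaussianReal (t : ℝ) :
    ∫ x : ℝ, x ^ 2 * Real.exp (t * x) ∂(gaussianReal 0 1)
      = (1 + t * t) * Real.exp (t ^ 2 / 2) := by
  rw [integral_pow_mul_exp_gaussianReal 2 t, iteratedDeriv_succ, iteratedDeriv_one,
    funext fun s => (hasDerivAt_exp_sq_div_two s).deriv]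
  have h := (hasDerivAt_id t).mul (hasDerivAt_exp_sq_div_two t)
  have h' := h.deriv
  simp only [id] at h'
  refine Eq.trans ?_ (h'.trans ?_)
  · rfl
  · ring

variable {κ : Type*} [Fintype κ]

/-- The standard Gaussian measure on `κ → ℝ`. -/
noncomputable abbrev gaussPi (κ : Type*) [Fintype κ] : Measure (κ → ℝ) :=
  Measure.pi fun _ => gaussianReal 0 1

lemma prod_pow_mul_exp (n : κ → ℕ) (t x : κ → ℝ) :
    ∏ l, (x l ^ n l * Real.exp (t l * x l)) = (∏ l, x l ^ n l) * Real.exp (∑ l, t l * x l) := by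
  rw [Finset.prod_mul_distrib, Real.exp_sum]

lemma integrable_prod_pow_mul_exp (n : κ → ℕ) (t : κ → ℝ) :
    Integrable (fun x : κ → ℝ => (∏ l, x l ^ n l) * Real.exp (∑ l, t l * x l)) (gaussPi κ) := by
  simp_rw [← prod_pow_mul_exp]
  exact Integrable.fintype_prod (fun l => integrable_pow_mul_exp_gaussianReal (n l) (t l))

lemma integral_prod_pow_mul_exp (n : κ → ℕ) (t p : κ → ℝ)
    (hp : ∀ l, ∫ x : ℝ, x ^ n l * Real.exp (t l * x) ∂(gaussianReal 0 1)
      = p l * Real.exp (t l ^ 2 / 2)) :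
    ∫ x : κ → ℝ, (∏ l, x l ^ n l) * Real.exp (∑ l, t l * x l) ∂(gaussPi κ)
      = (∏ l, p l) * Real.exp ((∑ l, t l * t l) / 2) := by
  simp_rw [← prod_pow_mul_exp]
  rw [integral_fintype_prod_eq_prod (fun l (y : ℝ) => y ^ n l * Real.exp (t l * y))]
  simp_rw [hp]
  rw [Finset.prod_mul_distrib, ← Real.exp_sum, Finset.sum_div]
  simp_rw [pow_two]

lemma integrable_exp_gaussPi (t : κ → ℝ) :
    Integrable (fun x : κ → ℝ => Real.exp (∑ l, t l * x l)) (gaussPi κ) := by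
  simpa using integrable_prod_pow_mul_exp (fun _ => 0) t

lemma integral_exp_gaussPi (t : κ → ℝ) :
    ∫ x : κ → ℝ, Real.exp (∑ l, t l * x l) ∂(gaussPi κ) = Real.exp ((∑ l, t l * t l) / 2) := by
  have h := integral_prod_pow_mul_exp (fun _ => 0) t (fun _ => 1)
    (fun l => by simpa using integral_exp_gaussianReal (t l))
  simpa using h

lemma prod_pow_single [DecidableEq κ] (j : κ) (x : κ → ℝ) :
    ∏ l, x l ^ (if l = j then 1 else 0) = x j := by
  simp [Finset.prod_ite_eq', apply_ite]

lemma integrable_mul_exp_gaussPi [DecidableEq κ] (j : κ) (t : κ → ℝ) :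
    Integrable (fun x : κ → ℝ => x j * Real.exp (∑ l, t l * x l)) (gaussPi κ) := by
  have h := integrable_prod_pow_mul_exp (fun l => if l = j then 1 else 0) t
  simp_rw [prod_pow_single] at h
  exact h

lemma integral_mul_exp_gaussPi [DecidableEq κ] (j : κ) (t : κ → ℝ) :
    ∫ x : κ → ℝ, x j * Real.exp (∑ l, t l * x l) ∂(gaussPi κ)
      = t j * Real.exp ((∑ l, t l * t l) / 2) := by
  have h := integral_prod_pow_mul_exp (fun l => if l = j then 1 else 0) t
    (fun l => t l ^ (if l = j then 1 else 0)) (fun l => by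
      by_cases hl : l = j
      · simpa [hl] using integral_mul_exp_gaussianReal (t j)
      · simpa [hl] using integral_exp_gaussianReal (t l))
  simp_rw [prod_pow_single] at h
  exact h

lemma prod_pow_pair [DecidableEq κ] (j k : κ) (x : κ → ℝ) :
    ∏ l, x l ^ ((if l = j then 1 else 0) + (if l = k then 1 else 0)) = x j * x k := by
  simp_rw [pow_add]
  rw [Finset.prod_mul_distrib, prod_pow_single, prod_pow_single]

lemma integrable_mul_mul_exp_gaussPi [DecidableEq κ] (j k : κ) (t : κ → ℝ) :
    Integrable (fun x : κ → ℝ => x j * x k * Real.exp (∑ l, t l * x l)) (gaussPi κ) := by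
  have h := integrable_prod_pow_mul_exp
    (fun l => (if l = j then 1 else 0) + (if l = k then 1 else 0)) t
  simp_rw [prod_pow_pair] at h
  exact h

lemma integral_mul_mul_exp_gaussPi [DecidableEq κ] (j k : κ) (t : κ → ℝ) :
    ∫ x : κ → ℝ, x j * x k * Real.exp (∑ l, t l * x l) ∂(gaussPi κ)
      = ((if j = k then 1 else 0) + t j * t k) * Real.exp ((∑ l, t l * t l) / 2) := by
  by_cases hjk : j = k
  · subst hjk
    have h := integral_prod_pow_mul_exp
      (fun l => (if l = j then 1 else 0) + (if l = j then 1 else 0)) t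
      (fun l => (1 + t l * t l) ^ (if l = j then 1 else 0)) (fun l => by
        by_cases hl : l = j
        · simpa [hl] using integral_sq_mul_exp_gaussianReal (t j)
        · simpa [hl] using integral_exp_gaussianReal (t l))
    simp_rw [prod_pow_pair] at h
    rw [h, prod_pow_single j (fun l => 1 + t l * t l)]
    simp
  · have h := integral_prod_pow_mul_exp
      (fun l => (if l = j then 1 else 0) + (if l = k then 1 else 0)) t
      (fun l => t l ^ ((if l = j then 1 else 0) + (if l = k then 1 else 0))) (fun l => by
        by_cases hl : l = j
        · subst hl
          simpa [hjk] using integral_mul_exp_gaussianReal (t l)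
        · by_cases hl' : l = k
          · subst hl'
            simpa [hl] using integral_mul_exp_gaussianReal (t l)
          · simpa [hl, hl'] using integral_exp_gaussianReal (t l))
    simp_rw [prod_pow_pair] at h
    rw [h]
    simp [hjk]

lemma affine_mul_affine_mul_exp (u v t x : κ → ℝ) (c : ℝ) :
    ((∑ l, u l * x l) - c) * ((∑ l, v l * x l) - c) * Real.exp (∑ l, t l * x l)
      = (∑ j, ∑ k, u j * v k * (x j * x k * Real.exp (∑ l, t l * x l)))
        - c * (∑ j, (u j + v j) * (x j * Real.exp (∑ l, t l * x l)))
        + c ^ 2 * Real.exp (∑ l, t l * x l) := by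
  have h1 : ∑ j, ∑ k, u j * v k * (x j * x k * Real.exp (∑ l, t l * x l))
      = (∑ l, u l * x l) * (∑ l, v l * x l) * Real.exp (∑ l, t l * x l) := by
    rw [Finset.sum_mul_sum, Finset.sum_mul]
    refine Finset.sum_congr rfl fun j _ => ?_
    rw [Finset.sum_mul]
    exact Finset.sum_congr rfl fun k _ => by ring
  have h2 : ∑ j, (u j + v j) * (x j * Real.exp (∑ l, t l * x l))
      = ((∑ l, u l * x l) + (∑ l, v l * x l)) * Real.exp (∑ l, t l * x l) := by
    rw [← Finset.sum_add_distrib, Finset.sum_mul]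
    exact Finset.sum_congr rfl fun k _ => by ring
  rw [h1, h2]
  ring

lemma integrable_affine_mul_affine_mul_exp (u v t : κ → ℝ) (c : ℝ) :
    Integrable (fun x : κ → ℝ =>
      ((∑ l, u l * x l) - c) * ((∑ l, v l * x l) - c) * Real.exp (∑ l, t l * x l))
      (gaussPi κ) := by
  classical
  simp_rw [affine_mul_affine_mul_exp]
  refine Integrable.add (Integrable.sub ?_ ?_) ?_
  · exact integrable_finsetSum _ fun j _ => integrable_finsetSum _ fun k _ =>
      (integrable_mul_mul_exp_gaussPi j k t).const_mul _
  · exact (integrable_finsetSum _ fun j _ =>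
      (integrable_mul_exp_gaussPi j t).const_mul _).const_mul _
  · exact (integrable_exp_gaussPi t).const_mul _

lemma integral_affine_mul_affine_mul_exp (u v t : κ → ℝ) (c : ℝ) :
    ∫ x : κ → ℝ,
      ((∑ l, u l * x l) - c) * ((∑ l, v l * x l) - c) * Real.exp (∑ l, t l * x l) ∂(gaussPi κ)
      = ((∑ l, u l * v l) + ((∑ l, u l * t l) - c) * ((∑ l, v l * t l) - c))
        * Real.exp ((∑ l, t l * t l) / 2) := by
  classical
  simp_rw [affine_mul_affine_mul_exp]
  have i1 : ∀ j k, Integrable (fun x : κ → ℝ =>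
      u j * v k * (x j * x k * Real.exp (∑ l, t l * x l))) (gaussPi κ) := fun j k =>
    (integrable_mul_mul_exp_gaussPi j k t).const_mul _
  have i2 : ∀ j, Integrable (fun x : κ → ℝ =>
      (u j + v j) * (x j * Real.exp (∑ l, t l * x l))) (gaussPi κ) := fun j =>
    (integrable_mul_exp_gaussPi j t).const_mul _
  have j1 : Integrable (fun x : κ → ℝ =>
      ∑ j, ∑ k, u j * v k * (x j * x k * Real.exp (∑ l, t l * x l))) (gaussPi κ) :=
    integrable_finsetSum _ fun j _ => integrable_finsetSum _ fun k _ => i1 j k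
  have j2 : Integrable (fun x : κ → ℝ =>
      c * ∑ j, (u j + v j) * (x j * Real.exp (∑ l, t l * x l))) (gaussPi κ) :=
    (integrable_finsetSum _ fun j _ => i2 j).const_mul _
  have j3 := (integrable_exp_gaussPi t).const_mul (c ^ 2)
  have j12 : Integrable (fun x : κ → ℝ =>
      ∑ j, ∑ k, u j * v k * (x j * x k * Real.exp (∑ l, t l * x l))
        - c * ∑ j, (u j + v j) * (x j * Real.exp (∑ l, t l * x l))) (gaussPi κ) := j1.sub j2
  rw [integral_add j12 j3, integral_sub j1 j2, integral_const_mul, integral_const_mul,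
    integral_finsetSum _ fun j _ => i2 j,
    integral_finsetSum _ fun j _ => integrable_finsetSum _ fun k _ => i1 j k]
  simp_rw [integral_finsetSum _ fun k _ => i1 _ k, integral_const_mul,
    integral_mul_mul_exp_gaussPi, integral_mul_exp_gaussPi, integral_exp_gaussPi]
  have h1 : ∑ j, ∑ k, u j * v k *
      (((if j = k then 1 else 0) + t j * t k) * Real.exp ((∑ l, t l * t l) / 2))
      = ((∑ l, u l * v l) + (∑ l, u l * t l) * (∑ l, v l * t l))
        * Real.exp ((∑ l, t l * t l) / 2) := by
    rw [Finset.sum_mul_sum, ← Finset.sum_add_distrib, Finset.sum_mul]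
    refine Finset.sum_congr rfl fun j _ => ?_
    simp_rw [add_mul, mul_add]
    rw [Finset.sum_add_distrib, Finset.sum_mul]
    congr 1
    · simp [mul_assoc]
    · exact Finset.sum_congr rfl fun k _ => by ring
  have h2 : ∑ j, (u j + v j) * (t j * Real.exp ((∑ l, t l * t l) / 2))
      = ((∑ l, u l * t l) + (∑ l, v l * t l)) * Real.exp ((∑ l, t l * t l) / 2) := by
    rw [← Finset.sum_add_distrib, Finset.sum_mul]
    exact Finset.sum_congr rfl fun k _ => by ring
  rw [h1, h2]
  ring

end GaussianMoments

section CavityEstimates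

variable {κ α : Type*} [Fintype κ] [Fintype α]

/-- A probability vector `w` on `α` together with vectors `a s` whose Gram matrix has constant
diagonal `1 - δ` and entries bounded by one. -/
structure CavityData (w : α → ℝ) (a : α → κ → ℝ) (q δ : ℝ) : Prop where
  weight_nonneg : ∀ s, 0 ≤ w s
  weight_sum : ∑ s, w s = 1
  q_nonneg : 0 ≤ q
  q_le_one : q ≤ 1
  delta_nonneg : 0 ≤ δ
  delta_le_one : δ ≤ 1
  diag : ∀ s, a s ⬝ᵥ a s = 1 - δ
  abs_le_one : ∀ s t, |a s ⬝ᵥ a t| ≤ 1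

/-- The barycenter of the vectors `a s` with weights `w`. -/
def bary (w : α → ℝ) (a : α → κ → ℝ) : κ → ℝ := ∑ s, w s • a s

/-- The averaged deviation of the Gram matrix from `q`. -/
def dev (w : α → ℝ) (a : α → κ → ℝ) (q : ℝ) : ℝ :=
  ∑ s, ∑ t, w s * w t * |a s ⬝ᵥ a t - q|

lemma bary_dotProduct (w : α → ℝ) (a : α → κ → ℝ) (v : κ → ℝ) :
    bary w a ⬝ᵥ v = ∑ s, w s * (a s ⬝ᵥ v) := by
  simp [bary, sum_dotProduct, smul_dotProduct]

lemma abs_weighted_sum_sub_le {w : α → ℝ} (hw : ∀ s, 0 ≤ w s) (hw1 : ∑ s, w s = 1)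
    (f : α → ℝ) (c : ℝ) : |(∑ s, w s * f s) - c| ≤ ∑ s, w s * |f s - c| := by
  have : (∑ s, w s * f s) - c = ∑ s, w s * (f s - c) := by
    simp_rw [mul_sub]
    rw [Finset.sum_sub_distrib, ← Finset.sum_mul, hw1, one_mul]
  rw [this]
  refine (Finset.abs_sum_le_sum_abs _ _).trans (le_of_eq ?_)
  exact Finset.sum_congr rfl fun s _ => by rw [abs_mul, abs_of_nonneg (hw s)]

lemma weighted_sum_le_of_le {w : α → ℝ} (hw : ∀ s, 0 ≤ w s) (hw1 : ∑ s, w s = 1)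
    {f : α → ℝ} {c : ℝ} (hf : ∀ s, f s ≤ c) : ∑ s, w s * f s ≤ c := by
  calc ∑ s, w s * f s ≤ ∑ s, w s * c :=
        Finset.sum_le_sum fun s _ => mul_le_mul_of_nonneg_left (hf s) (hw s)
    _ = c := by rw [← Finset.sum_mul, hw1, one_mul]

namespace CavityData

variable {w : α → ℝ} {a : α → κ → ℝ} {q δ : ℝ}

lemma abs_bary_dotProduct_le_one (H : CavityData w a q δ) (s : α) :
    |bary w a ⬝ᵥ a s| ≤ 1 := by
  have h := abs_weighted_sum_sub_le H.weight_nonneg H.weight_sum (fun t => a t ⬝ᵥ a s) 0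
  rw [← bary_dotProduct, sub_zero] at h
  refine h.trans (weighted_sum_le_of_le H.weight_nonneg H.weight_sum fun t => ?_)
  simpa using H.abs_le_one t s

lemma abs_bary_dotProduct_bary_le_one (H : CavityData w a q δ) :
    |bary w a ⬝ᵥ bary w a| ≤ 1 := by
  have h := abs_weighted_sum_sub_le H.weight_nonneg H.weight_sum
    (fun t => a t ⬝ᵥ bary w a) 0
  rw [← bary_dotProduct, sub_zero] at h
  refine h.trans (weighted_sum_le_of_le H.weight_nonneg H.weight_sum fun t => ?_)
  rw [sub_zero, dotProduct_comm]
  exact H.abs_bary_dotProduct_le_one t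

lemma abs_bary_dotProduct_sub_le (H : CavityData w a q δ) (s : α) :
    |bary w a ⬝ᵥ a s - q| ≤ ∑ t, w t * |a s ⬝ᵥ a t - q| := by
  have h := abs_weighted_sum_sub_le H.weight_nonneg H.weight_sum (fun t => a t ⬝ᵥ a s) q
  rw [← bary_dotProduct] at h
  simpa only [dotProduct_comm (a s)] using h

lemma weighted_sum_abs_bary_sub_le (H : CavityData w a q δ) :
    ∑ s, w s * |bary w a ⬝ᵥ a s - q| ≤ dev w a q := by
  refine Finset.sum_le_sum fun s _ => ?_
  simp_rw [mul_assoc]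
  rw [← Finset.mul_sum]
  exact mul_le_mul_of_nonneg_left (H.abs_bary_dotProduct_sub_le s) (H.weight_nonneg s)

lemma abs_bary_dotProduct_bary_sub_le (H : CavityData w a q δ) :
    |bary w a ⬝ᵥ bary w a - q| ≤ dev w a q := by
  have h := abs_weighted_sum_sub_le H.weight_nonneg H.weight_sum
    (fun t => a t ⬝ᵥ bary w a) q
  rw [← bary_dotProduct] at h
  refine h.trans (le_trans (le_of_eq ?_) H.weighted_sum_abs_bary_sub_le)
  simp_rw [dotProduct_comm (bary w a)]

/-- The error attached to a pair of replicas. -/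
def pairError (w : α → ℝ) (a : α → κ → ℝ) (q δ : ℝ) (s t : α) : ℝ :=
  |a s ⬝ᵥ a t - q| + |bary w a ⬝ᵥ a s - q| + |bary w a ⬝ᵥ a t - q|
    + 3 * |bary w a ⬝ᵥ bary w a - q| + 2 * δ

lemma sum_pairError_le (H : CavityData w a q δ) :
    ∑ s, ∑ t, w s * w t * pairError w a q δ s t ≤ 6 * (dev w a q + δ) := by
  have h1 := H.weighted_sum_abs_bary_sub_le
  have h2 := H.abs_bary_dotProduct_bary_sub_le
  have h3 := H.delta_nonneg
  have : ∑ s, ∑ t, w s * w t * pairError w a q δ s t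
      = dev w a q + 2 * (∑ s, w s * |bary w a ⬝ᵥ a s - q|)
        + 3 * |bary w a ⬝ᵥ bary w a - q| + 2 * δ := by
    have e1 : ∀ f : α → ℝ, ∑ s, ∑ t, w s * w t * f s = ∑ s, w s * f s := fun f => by
      refine Finset.sum_congr rfl fun s _ => ?_
      rw [← Finset.sum_mul, ← Finset.mul_sum, H.weight_sum, mul_one]
    have e2 : ∀ f : α → ℝ, ∑ s, ∑ t, w s * w t * f t = ∑ s, w s * f s := fun f => by
      rw [Finset.sum_comm, ← e1]
      exact Finset.sum_congr rfl fun s _ => Finset.sum_congr rfl fun t _ => by ring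
    have e3 : ∀ c : ℝ, ∑ s, ∑ t, w s * w t * c = c := fun c => by
      rw [e1 (fun _ => c), ← Finset.sum_mul, H.weight_sum, one_mul]
    simp only [pairError, mul_add, Finset.sum_add_distrib]
    rw [e1 (fun s => |bary w a ⬝ᵥ a s - q|), e2 (fun s => |bary w a ⬝ᵥ a s - q|), e3, e3, dev]
    ring
  rw [this]
  linarith

end CavityData

lemma integrable_exp_dotProduct (t : κ → ℝ) :
    Integrable (fun x : κ → ℝ => Real.exp (t ⬝ᵥ x)) (gaussPi κ) :=
  integrable_exp_gaussPi t

lemma integral_exp_dotProduct (t : κ → ℝ) :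
    ∫ x : κ → ℝ, Real.exp (t ⬝ᵥ x) ∂(gaussPi κ) = Real.exp (t ⬝ᵥ t / 2) :=
  integral_exp_gaussPi t

lemma weighted_sum_sq (w f : α → ℝ) :
    (∑ s, w s * f s) ^ 2 = ∑ s, ∑ t, w s * w t * (f s * f t) := by
  rw [sq, Finset.sum_mul_sum]
  exact Finset.sum_congr rfl fun s _ => Finset.sum_congr rfl fun t _ => by ring

lemma integrable_weighted_sum_sq {Ω : Type*} [MeasurableSpace Ω] {μ : Measure Ω} (w : α → ℝ)
    {f : α → Ω → ℝ}
    (hf : ∀ s t, Integrable (fun x => f s x * f t x) μ) :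
    Integrable (fun x => (∑ s, w s * f s x) ^ 2) μ := by
  simp_rw [weighted_sum_sq]
  exact integrable_finsetSum _ fun s _ => integrable_finsetSum _ fun t _ => (hf s t).const_mul _

lemma CavityData.integral_weighted_sum_sq_le {w : α → ℝ} {a : α → κ → ℝ} {q δ : ℝ}
    (H : CavityData w a q δ) {μ : Measure (κ → ℝ)} {f : α → (κ → ℝ) → ℝ} {C : ℝ} (hC : 0 ≤ C)
    (hf : ∀ s t, Integrable (fun x => f s x * f t x) μ)
    (hb : ∀ s t, ∫ x, f s x * f t x ∂μ ≤ C * pairError w a q δ s t) :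
    ∫ x, (∑ s, w s * f s x) ^ 2 ∂μ ≤ C * (6 * (dev w a q + δ)) := by
  simp_rw [weighted_sum_sq]
  rw [integral_finsetSum _ fun s _ => integrable_finsetSum _ fun t _ => (hf s t).const_mul _]
  simp_rw [integral_finsetSum _ fun t _ => (hf _ t).const_mul _, integral_const_mul]
  refine le_trans ?_ (mul_le_mul_of_nonneg_left H.sum_pairError_le hC)
  rw [Finset.mul_sum]
  refine Finset.sum_le_sum fun s _ => ?_
  rw [Finset.mul_sum]
  refine Finset.sum_le_sum fun t _ => ?_
  calc w s * w t * ∫ x, f s x * f t x ∂μ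
      ≤ w s * w t * (C * pairError w a q δ s t) :=
        mul_le_mul_of_nonneg_left (hb s t) (mul_nonneg (H.weight_nonneg s) (H.weight_nonneg t))
    _ = _ := by ring

lemma abs_exp_sub_exp_le {x y M : ℝ} (hx : x ≤ M) (hy : y ≤ M) :
    |Real.exp x - Real.exp y| ≤ Real.exp M * |x - y| := by
  have key : ∀ {x y : ℝ}, x ≤ M → y ≤ x → |Real.exp x - Real.exp y| ≤ Real.exp M * |x - y| := by
    intro x y hx hyx
    rw [abs_of_nonneg (sub_nonneg.2 (Real.exp_le_exp.2 hyx)), abs_of_nonneg (sub_nonneg.2 hyx)]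
    have h1 : Real.exp y = Real.exp x * Real.exp (y - x) := by rw [← Real.exp_add]; ring_nf
    have h2 := Real.add_one_le_exp (y - x)
    have h3 := Real.exp_pos x
    calc Real.exp x - Real.exp y ≤ Real.exp x * (x - y) := by rw [h1]; nlinarith
      _ ≤ Real.exp M * (x - y) :=
        mul_le_mul_of_nonneg_right (Real.exp_le_exp.2 hx) (sub_nonneg.2 hyx)
  rcases le_total y x with h | h
  · exact key hx h
  · rw [abs_sub_comm, abs_sub_comm x]
    exact key hy h

namespace CavityData

variable {w : α → ℝ} {a : α → κ → ℝ} {q δ : ℝ}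

/-- The exponential cavity average centered at its Gaussian approximation. -/
noncomputable def expDiff (w : α → ℝ) (a : α → κ → ℝ) (q b : ℝ) (x : κ → ℝ) : ℝ :=
  ∑ s, w s * (Real.exp (b * (a s ⬝ᵥ x))
    - Real.exp (b ^ 2 * (1 - q) / 2 + b * (bary w a ⬝ᵥ x)))

/-- The exponentially tilted centered field. -/
noncomputable def tiltDiff (w : α → ℝ) (a : α → κ → ℝ) (q b : ℝ) (x : κ → ℝ) : ℝ :=
  ∑ s, w s * ((a s ⬝ᵥ x - bary w a ⬝ᵥ x - b * (1 - q)) * Real.exp (b * (a s ⬝ᵥ x)))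

lemma exp_diff_mul_exp_diff (b c : ℝ) (u v m x : κ → ℝ) :
    (Real.exp (b * (u ⬝ᵥ x)) - Real.exp (c + b * (m ⬝ᵥ x)))
        * (Real.exp (b * (v ⬝ᵥ x)) - Real.exp (c + b * (m ⬝ᵥ x)))
      = Real.exp ((b • (u + v)) ⬝ᵥ x) - Real.exp c * Real.exp ((b • (u + m)) ⬝ᵥ x)
        - Real.exp c * Real.exp ((b • (v + m)) ⬝ᵥ x)
        + Real.exp (2 * c) * Real.exp ((b • (m + m)) ⬝ᵥ x) := by
  simp only [smul_dotProduct, add_dotProduct, smul_eq_mul, mul_add, Real.exp_add, two_mul]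
  ring

lemma integrable_exp_diff_mul (b c : ℝ) (u v m : κ → ℝ) :
    Integrable (fun x => (Real.exp (b * (u ⬝ᵥ x)) - Real.exp (c + b * (m ⬝ᵥ x)))
        * (Real.exp (b * (v ⬝ᵥ x)) - Real.exp (c + b * (m ⬝ᵥ x)))) (gaussPi κ) := by
  simp_rw [exp_diff_mul_exp_diff]
  exact (((integrable_exp_dotProduct _).sub ((integrable_exp_dotProduct _).const_mul _)).sub
    ((integrable_exp_dotProduct _).const_mul _)).add ((integrable_exp_dotProduct _).const_mul _)

lemma integral_exp_diff_mul (b c : ℝ) (u v m : κ → ℝ) :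
    ∫ x, (Real.exp (b * (u ⬝ᵥ x)) - Real.exp (c + b * (m ⬝ᵥ x)))
        * (Real.exp (b * (v ⬝ᵥ x)) - Real.exp (c + b * (m ⬝ᵥ x))) ∂(gaussPi κ)
      = Real.exp (b ^ 2 * (u ⬝ᵥ u + v ⬝ᵥ v + 2 * (u ⬝ᵥ v)) / 2)
        - Real.exp (c + b ^ 2 * (u ⬝ᵥ u + m ⬝ᵥ m + 2 * (m ⬝ᵥ u)) / 2)
        - Real.exp (c + b ^ 2 * (v ⬝ᵥ v + m ⬝ᵥ m + 2 * (m ⬝ᵥ v)) / 2)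
        + Real.exp (2 * c + b ^ 2 * (4 * (m ⬝ᵥ m)) / 2) := by
  simp_rw [exp_diff_mul_exp_diff]
  have i (t : κ → ℝ) := integrable_exp_dotProduct t
  have j (k : ℝ) (t : κ → ℝ) := (i t).const_mul k
  have p (t₁ t₂ : κ → ℝ) (k : ℝ) : Integrable
      (fun x => Real.exp (t₁ ⬝ᵥ x) - k * Real.exp (t₂ ⬝ᵥ x)) (gaussPi κ) := (i _).sub (j _ _)
  have r (t₁ t₂ t₃ : κ → ℝ) (k l : ℝ) : Integrable (fun x => Real.exp (t₁ ⬝ᵥ x)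
      - k * Real.exp (t₂ ⬝ᵥ x) - l * Real.exp (t₃ ⬝ᵥ x)) (gaussPi κ) := (p _ _ _).sub (j _ _)
  rw [integral_add (r _ _ _ _ _) (j _ _), integral_sub (p _ _ _) (j _ _),
    integral_sub (i _) (j _ _)]
  simp_rw [integral_const_mul, integral_exp_dotProduct, ← Real.exp_add]
  simp only [smul_dotProduct, add_dotProduct, dotProduct_add, dotProduct_smul, smul_eq_mul]
  rw [dotProduct_comm v u, dotProduct_comm u m, dotProduct_comm v m]
  ring_nf

lemma integral_expDiff_sq_le (H : CavityData w a q δ) (b : ℝ) :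
    ∫ x, expDiff w a q b x ^ 2 ∂(gaussPi κ)
      ≤ b ^ 2 * Real.exp (3 * b ^ 2) * (6 * (dev w a q + δ)) := by
  refine H.integral_weighted_sum_sq_le (by positivity)
    (fun s t => integrable_exp_diff_mul b _ (a s) (a t) (bary w a)) fun s t => ?_
  rw [integral_exp_diff_mul, H.diag s, H.diag t]
  have hst := abs_le.1 (H.abs_le_one s t)
  have hs := abs_le.1 (H.abs_bary_dotProduct_le_one s)
  have ht := abs_le.1 (H.abs_bary_dotProduct_le_one t)
  have h0 := abs_le.1 H.abs_bary_dotProduct_bary_le_one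
  have hq := H.q_nonneg
  have hq1 := H.q_le_one
  have hδ := H.delta_nonneg
  have hb := sq_nonneg b
  set R := a s ⬝ᵥ a t
  set Rs := bary w a ⬝ᵥ a s
  set Rt := bary w a ⬝ᵥ a t
  set R0 := bary w a ⬝ᵥ bary w a
  have hbase : b ^ 2 * (1 + q) ≤ 3 * b ^ 2 := by nlinarith
  have key : ∀ y z : ℝ, z ≤ 3 → y = b ^ 2 * z → |Real.exp y - Real.exp (b ^ 2 * (1 + q))|
      ≤ Real.exp (3 * b ^ 2) * (b ^ 2 * |z - (1 + q)|) := by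
    rintro y z hz rfl
    refine (abs_exp_sub_exp_le (by nlinarith) hbase).trans (le_of_eq ?_)
    rw [← mul_sub, abs_mul, abs_of_nonneg hb]
  have k1 := key (b ^ 2 * (1 - δ + (1 - δ) + 2 * R) / 2) (1 - δ + R) (by linarith) (by ring)
  have k2 := key (b ^ 2 * (1 - q) / 2 + b ^ 2 * (1 - δ + R0 + 2 * Rs) / 2)
    ((1 - q) / 2 + (1 - δ + R0) / 2 + Rs) (by linarith) (by ring)
  have k3 := key (b ^ 2 * (1 - q) / 2 + b ^ 2 * (1 - δ + R0 + 2 * Rt) / 2)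
    ((1 - q) / 2 + (1 - δ + R0) / 2 + Rt) (by linarith) (by ring)
  have k4 := key (2 * (b ^ 2 * (1 - q) / 2) + b ^ 2 * (4 * R0) / 2)
    ((1 - q) + 2 * R0) (by linarith) (by ring)
  have z1 : |1 - δ + R - (1 + q)| ≤ |R - q| + δ := by
    grind
  have z2 : |(1 - q) / 2 + (1 - δ + R0) / 2 + Rs - (1 + q)| ≤ |Rs - q| + |R0 - q| / 2 + δ / 2 := by
    grind
  have z3 : |(1 - q) / 2 + (1 - δ + R0) / 2 + Rt - (1 + q)| ≤ |Rt - q| + |R0 - q| / 2 + δ / 2 := by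
    grind
  have z4 : |(1 - q) + 2 * R0 - (1 + q)| ≤ 2 * |R0 - q| := by
    grind
  have hE := Real.exp_pos (3 * b ^ 2)
  have hEb : 0 ≤ b ^ 2 * Real.exp (3 * b ^ 2) := by positivity
  have hz := mul_le_mul_of_nonneg_left (add_le_add (add_le_add (add_le_add z1 z2) z3) z4) hEb
  have a1 := le_abs_self (Real.exp (b ^ 2 * (1 - δ + (1 - δ) + 2 * R) / 2)
    - Real.exp (b ^ 2 * (1 + q)))
  have a2 := neg_abs_le (Real.exp (b ^ 2 * (1 - q) / 2 + b ^ 2 * (1 - δ + R0 + 2 * Rs) / 2)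
    - Real.exp (b ^ 2 * (1 + q)))
  have a3 := neg_abs_le (Real.exp (b ^ 2 * (1 - q) / 2 + b ^ 2 * (1 - δ + R0 + 2 * Rt) / 2)
    - Real.exp (b ^ 2 * (1 + q)))
  have a4 := le_abs_self (Real.exp (2 * (b ^ 2 * (1 - q) / 2) + b ^ 2 * (4 * R0) / 2)
    - Real.exp (b ^ 2 * (1 + q)))
  unfold pairError
  linarith

lemma integrable_expDiff_sq (w : α → ℝ) (a : α → κ → ℝ) (q b : ℝ) :
    Integrable (fun x => expDiff w a q b x ^ 2) (gaussPi κ) :=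
  integrable_weighted_sum_sq w fun s t => integrable_exp_diff_mul b _ (a s) (a t) (bary w a)

lemma tilt_mul_tilt (b c : ℝ) (u v m x : κ → ℝ) :
    ((u ⬝ᵥ x - m ⬝ᵥ x - c) * Real.exp (b * (u ⬝ᵥ x)))
        * ((v ⬝ᵥ x - m ⬝ᵥ x - c) * Real.exp (b * (v ⬝ᵥ x)))
      = ((u - m) ⬝ᵥ x - c) * ((v - m) ⬝ᵥ x - c) * Real.exp ((b • (u + v)) ⬝ᵥ x) := by
  simp only [smul_dotProduct, add_dotProduct, sub_dotProduct, smul_eq_mul, mul_add, Real.exp_add]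
  ring

lemma integrable_tilt_mul_tilt (b c : ℝ) (u v m : κ → ℝ) :
    Integrable (fun x => ((u ⬝ᵥ x - m ⬝ᵥ x - c) * Real.exp (b * (u ⬝ᵥ x)))
        * ((v ⬝ᵥ x - m ⬝ᵥ x - c) * Real.exp (b * (v ⬝ᵥ x)))) (gaussPi κ) := by
  simp_rw [tilt_mul_tilt]
  exact integrable_affine_mul_affine_mul_exp _ _ _ _

lemma integral_tilt_mul_tilt (b c : ℝ) (u v m : κ → ℝ) :
    ∫ x, ((u ⬝ᵥ x - m ⬝ᵥ x - c) * Real.exp (b * (u ⬝ᵥ x)))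
        * ((v ⬝ᵥ x - m ⬝ᵥ x - c) * Real.exp (b * (v ⬝ᵥ x))) ∂(gaussPi κ)
      = ((u - m) ⬝ᵥ (v - m)
          + ((u - m) ⬝ᵥ (b • (u + v)) - c) * ((v - m) ⬝ᵥ (b • (u + v)) - c))
        * Real.exp ((b • (u + v)) ⬝ᵥ (b • (u + v)) / 2) := by
  simp_rw [tilt_mul_tilt]
  exact integral_affine_mul_affine_mul_exp _ _ _ _

lemma integral_tiltDiff_sq_le (H : CavityData w a q δ) (b : ℝ) :
    ∫ x, tiltDiff w a q b x ^ 2 ∂(gaussPi κ)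
      ≤ (1 + 7 * b ^ 2) * Real.exp (2 * b ^ 2) * (6 * (dev w a q + δ)) := by
  refine H.integral_weighted_sum_sq_le (by positivity)
    (fun s t => integrable_tilt_mul_tilt b _ (a s) (a t) (bary w a)) fun s t => ?_
  rw [integral_tilt_mul_tilt]
  simp only [smul_dotProduct, add_dotProduct, dotProduct_add, dotProduct_smul, smul_eq_mul,
    sub_dotProduct, dotProduct_sub]
  rw [H.diag s, H.diag t, dotProduct_comm (a t) (a s), dotProduct_comm (a s) (bary w a)]
  have hst := abs_le.1 (H.abs_le_one s t)
  have hs := abs_le.1 (H.abs_bary_dotProduct_le_one s)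
  have ht := abs_le.1 (H.abs_bary_dotProduct_le_one t)
  have hq := H.q_nonneg
  have hq1 := H.q_le_one
  have hδ := H.delta_nonneg
  have hδ1 := H.delta_le_one
  have hb := sq_nonneg b
  unfold pairError
  set R := a s ⬝ᵥ a t
  set Rs := bary w a ⬝ᵥ a s
  set Rt := bary w a ⬝ᵥ a t
  set R0 := bary w a ⬝ᵥ bary w a
  set P := |R - q| + |Rs - q| + |Rt - q| + 3 * |R0 - q| + 2 * δ
  have hP : 0 ≤ P := by positivity
  have h1 : R - Rs - (Rt - R0) ≤ P := by grind
  set u := R - Rs - Rt + (q - δ)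
  have h2 : |u| ≤ P := by grind
  have h3 : |u| ≤ 7 := by grind
  have h4 : u ^ 2 ≤ 7 * P := by
    rw [← sq_abs]
    nlinarith [abs_nonneg u]
  have h5 : R - Rs - (Rt - R0) + (b * (1 - δ - Rs + (R - Rt)) - b * (1 - q))
      * (b * (R - Rs + (1 - δ - Rt)) - b * (1 - q)) ≤ (1 + 7 * b ^ 2) * P := by
    have : (b * (1 - δ - Rs + (R - Rt)) - b * (1 - q))
      * (b * (R - Rs + (1 - δ - Rt)) - b * (1 - q)) = b ^ 2 * u ^ 2 := by
      simp only [u]; ring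
    rw [this]
    nlinarith
  have h6 : Real.exp ((b * (b * (1 - δ + R)) + b * (b * (R + (1 - δ)))) / 2)
      ≤ Real.exp (2 * b ^ 2) := by
    apply Real.exp_le_exp.2
    nlinarith
  have h7 : 0 ≤ (1 + 7 * b ^ 2) * P := by positivity
  calc _ ≤ ((1 + 7 * b ^ 2) * P) * Real.exp (2 * b ^ 2) := by
        refine (mul_le_mul_of_nonneg_right ?_ (Real.exp_pos _).le).trans
          (mul_le_mul_of_nonneg_left (h6.trans' (le_of_eq ?_)) h7)
        · refine h5.trans' (le_of_eq ?_)
          ring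
        · ring_nf
    _ = _ := by ring

lemma integrable_tiltDiff_sq (w : α → ℝ) (a : α → κ → ℝ) (q b : ℝ) :
    Integrable (fun x => tiltDiff w a q b x ^ 2) (gaussPi κ) :=
  integrable_weighted_sum_sq w fun s t => integrable_tilt_mul_tilt b _ (a s) (a t) (bary w a)

end CavityData

lemma cosh_pow_four_le (y : ℝ) : Real.cosh y ^ 4 ≤ Real.exp (4 * y) + Real.exp (-(4 * y)) := by
  have h : Real.cosh y ≤ Real.exp |y| := by
    rw [← Real.cosh_abs, Real.cosh_eq]
    have : Real.exp (-|y|) ≤ Real.exp |y| := Real.exp_le_exp.2 (by linarith [abs_nonneg y])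
    linarith
  have h4 : Real.cosh y ^ 4 ≤ Real.exp (4 * |y|) := by
    refine (pow_le_pow_left₀ (Real.cosh_pos y).le h 4).trans (le_of_eq ?_)
    rw [← Real.exp_nat_mul]
    norm_num
  refine h4.trans ?_
  rcases abs_choice y with hy | hy <;> rw [hy]
  · linarith [Real.exp_pos (-(4 * y))]
  · rw [mul_neg]
    linarith [Real.exp_pos (4 * y)]

/-- An integrable majorant of the averaged fourth power of `cosh`. -/
noncomputable def coshBound (w : α → ℝ) (a : α → κ → ℝ) (β h : ℝ) (x : κ → ℝ) : ℝ :=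
  ∑ s, w s * (Real.exp (4 * h) * Real.exp (((4 * β) • a s) ⬝ᵥ x)
    + Real.exp (-(4 * h)) * Real.exp (((-(4 * β)) • a s) ⬝ᵥ x))

lemma integrable_coshBound (w : α → ℝ) (a : α → κ → ℝ) (β h : ℝ) :
    Integrable (coshBound w a β h) (gaussPi κ) :=
  integrable_finsetSum _ fun _ _ => (((integrable_exp_dotProduct _).const_mul _).add
    ((integrable_exp_dotProduct _).const_mul _)).const_mul _

lemma CavityData.integral_coshBound_le {w : α → ℝ} {a : α → κ → ℝ} {q δ : ℝ}
    (H : CavityData w a q δ) (β h : ℝ) :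
    ∫ x, coshBound w a β h x ∂(gaussPi κ)
      ≤ (Real.exp (4 * h) + Real.exp (-(4 * h))) * Real.exp (8 * β ^ 2) := by
  have i (t : κ → ℝ) := integrable_exp_dotProduct t
  have j (k : ℝ) (t : κ → ℝ) := (i t).const_mul k
  have p (t₁ t₂ : κ → ℝ) (k l : ℝ) : Integrable
      (fun x => k * Real.exp (t₁ ⬝ᵥ x) + l * Real.exp (t₂ ⬝ᵥ x)) (gaussPi κ) :=
    (j _ _).add (j _ _)
  unfold coshBound
  rw [integral_finsetSum _ fun s _ => (p _ _ _ _).const_mul _]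
  simp_rw [integral_const_mul]
  refine weighted_sum_le_of_le H.weight_nonneg H.weight_sum fun s => ?_
  rw [integral_add (j _ _) (j _ _)]
  simp_rw [integral_const_mul, integral_exp_dotProduct, smul_dotProduct, dotProduct_smul, H.diag s,
    smul_eq_mul]
  have hδ := H.delta_nonneg
  have e1 : Real.exp (4 * β * (4 * β * (1 - δ)) / 2) ≤ Real.exp (8 * β ^ 2) :=
    Real.exp_le_exp.2 (by nlinarith [sq_nonneg β])
  have e2 : Real.exp (-(4 * β) * (-(4 * β) * (1 - δ)) / 2) ≤ Real.exp (8 * β ^ 2) :=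
    Real.exp_le_exp.2 (by nlinarith [sq_nonneg β])
  have := mul_le_mul_of_nonneg_left e1 (Real.exp_pos (4 * h)).le
  have := mul_le_mul_of_nonneg_left e2 (Real.exp_pos (-(4 * h))).le
  linarith

lemma CavityData.sum_cosh_pow_four_le {w : α → ℝ} {a : α → κ → ℝ} {q δ : ℝ}
    (H : CavityData w a q δ) (β h : ℝ) (x : κ → ℝ) :
    (∑ s, w s * Real.cosh (β * (a s ⬝ᵥ x) + h)) ^ 4 ≤ coshBound w a β h x := by
  refine (Real.pow_arith_mean_le_arith_mean_pow _ _ _ (fun s _ => H.weight_nonneg s) H.weight_sum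
    (fun s _ => (Real.cosh_pos _).le) 4).trans ?_
  refine Finset.sum_le_sum fun s _ => mul_le_mul_of_nonneg_left ?_ (H.weight_nonneg s)
  refine (cosh_pow_four_le _).trans (le_of_eq ?_)
  rw [smul_dotProduct, smul_dotProduct, ← Real.exp_add, ← Real.exp_add, smul_eq_mul, smul_eq_mul]
  ring_nf

end CavityEstimates

section PointwiseBound

lemma hasDerivAt_tanh (x : ℝ) : HasDerivAt Real.tanh (1 / Real.cosh x ^ 2) x := by
  have hc := (Real.cosh_pos x).ne'
  have h := (Real.hasDerivAt_sinh x).div (Real.hasDerivAt_cosh x) hc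
  have h1 : Real.cosh x * Real.cosh x - Real.sinh x * Real.sinh x = 1 := by
    linarith [Real.cosh_sq_sub_sinh_sq x, sq (Real.cosh x), sq (Real.sinh x)]
  rw [h1] at h
  exact h.congr_of_eventuallyEq (Filter.Eventually.of_forall Real.tanh_eq_sinh_div_cosh)

lemma abs_tanh_sub_tanh_le (x y : ℝ) : |Real.tanh x - Real.tanh y| ≤ |x - y| := by
  have h := convex_univ.norm_image_sub_le_of_norm_hasDerivWithin_le (𝕜 := ℝ) (f := Real.tanh)
    (C := 1) (x := y) (y := x) (fun z _ => (hasDerivAt_tanh z).hasDerivWithinAt)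
    (fun z _ => by
      rw [Real.norm_of_nonneg (by positivity), div_le_one (by positivity)]
      exact one_le_pow₀ (Real.one_le_cosh z))
    (Set.mem_univ _) (Set.mem_univ _)
  simpa using h

variable {κ α : Type*} [Fintype κ] [Fintype α]

/-- The quantity controlling the TAP error before integrating over the cavity fields. -/
noncomputable def tapBound (w : α → ℝ) (a : α → κ → ℝ) (q β h : ℝ) (x : κ → ℝ) : ℝ :=
  4 * (Real.exp (2 * h) * CavityData.expDiff w a q β x ^ 2
      + Real.exp (-(2 * h)) * CavityData.expDiff w a q (-β) x ^ 2)
    + β ^ 2 * (Real.exp (2 * h) * CavityData.tiltDiff w a q β x ^ 2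
      + Real.exp (-(2 * h)) * CavityData.tiltDiff w a q (-β) x ^ 2)

lemma integrable_tapBound (w : α → ℝ) (a : α → κ → ℝ) (q β h : ℝ) :
    Integrable (tapBound w a q β h) (gaussPi κ) :=
  ((((CavityData.integrable_expDiff_sq w a q β).const_mul _).add
    ((CavityData.integrable_expDiff_sq w a q (-β)).const_mul _)).const_mul _).add
    ((((CavityData.integrable_tiltDiff_sq w a q β).const_mul _).add
    ((CavityData.integrable_tiltDiff_sq w a q (-β)).const_mul _)).const_mul _)

/-- The constant in front of the deviation in the integrated TAP error. -/
noncomputable def tapConst (β h : ℝ) : ℝ :=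
  (Real.exp (2 * h) + Real.exp (-(2 * h))) *
    (4 * (β ^ 2 * Real.exp (3 * β ^ 2) * 6)
      + β ^ 2 * ((1 + 7 * β ^ 2) * Real.exp (2 * β ^ 2) * 6))

lemma tapConst_nonneg (β h : ℝ) : 0 ≤ tapConst β h := by
  unfold tapConst
  positivity

lemma CavityData.integral_tapBound_le {w : α → ℝ} {a : α → κ → ℝ} {q δ : ℝ}
    (H : CavityData w a q δ) (β h : ℝ) :
    ∫ x, tapBound w a q β h x ∂(gaussPi κ) ≤ tapConst β h * (dev w a q + δ) := by
  have i1 := (integrable_expDiff_sq w a q β).const_mul (Real.exp (2 * h))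
  have i2 := (integrable_expDiff_sq w a q (-β)).const_mul (Real.exp (-(2 * h)))
  have i3 := (integrable_tiltDiff_sq w a q β).const_mul (Real.exp (2 * h))
  have i4 := (integrable_tiltDiff_sq w a q (-β)).const_mul (Real.exp (-(2 * h)))
  have j1 : Integrable (fun x => 4 * (Real.exp (2 * h) * expDiff w a q β x ^ 2
    + Real.exp (-(2 * h)) * expDiff w a q (-β) x ^ 2)) (gaussPi κ) := (i1.add i2).const_mul 4
  have j2 : Integrable (fun x => β ^ 2 * (Real.exp (2 * h) * tiltDiff w a q β x ^ 2
    + Real.exp (-(2 * h)) * tiltDiff w a q (-β) x ^ 2)) (gaussPi κ) := (i3.add i4).const_mul _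
  unfold tapBound
  rw [integral_add j1 j2, integral_const_mul, integral_const_mul, integral_add i1 i2,
    integral_add i3 i4]
  simp_rw [integral_const_mul]
  have e1 := H.integral_expDiff_sq_le β
  have e2 := H.integral_expDiff_sq_le (-β)
  have e3 := H.integral_tiltDiff_sq_le β
  have e4 := H.integral_tiltDiff_sq_le (-β)
  rw [neg_sq] at e2 e4
  calc _ ≤ 4 * (Real.exp (2 * h) * (β ^ 2 * Real.exp (3 * β ^ 2) * (6 * (dev w a q + δ)))
          + Real.exp (-(2 * h)) * (β ^ 2 * Real.exp (3 * β ^ 2) * (6 * (dev w a q + δ))))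
        + β ^ 2 * (Real.exp (2 * h) *
            ((1 + 7 * β ^ 2) * Real.exp (2 * β ^ 2) * (6 * (dev w a q + δ)))
          + Real.exp (-(2 * h)) *
            ((1 + 7 * β ^ 2) * Real.exp (2 * β ^ 2) * (6 * (dev w a q + δ)))) := by
        gcongr
    _ = _ := by
        unfold tapConst
        ring

lemma exp_mul_expDiff {w : α → ℝ} (hw1 : ∑ s, w s = 1) (a : α → κ → ℝ) (q b h : ℝ) (x : κ → ℝ) :
    Real.exp h * CavityData.expDiff w a q b x
      = ∑ s, w s * Real.exp (b * (a s ⬝ᵥ x) + h)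
        - Real.exp (b ^ 2 * (1 - q) / 2) * Real.exp (b * (bary w a ⬝ᵥ x) + h) := by
  unfold CavityData.expDiff
  have h1 (s : α) : Real.exp h * (w s * (Real.exp (b * (a s ⬝ᵥ x))
      - Real.exp (b ^ 2 * (1 - q) / 2 + b * (bary w a ⬝ᵥ x))))
      = w s * Real.exp (b * (a s ⬝ᵥ x) + h) - w s * (Real.exp (b ^ 2 * (1 - q) / 2)
        * Real.exp (b * (bary w a ⬝ᵥ x) + h)) := by
    rw [Real.exp_add, Real.exp_add, Real.exp_add]
    ring
  rw [Finset.mul_sum]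
  simp_rw [h1]
  rw [Finset.sum_sub_distrib, ← Finset.sum_mul, hw1, one_mul]

lemma sq_half_sub_le {r P Q : ℝ} (hr : |r| ≤ 1) :
    (((1 - r) * P - (1 + r) * Q) / 2) ^ 2 ≤ 2 * (P ^ 2 + Q ^ 2) := by
  obtain ⟨h1, h2⟩ := abs_le.1 hr
  have e1 : (1 - r) ^ 2 * P ^ 2 ≤ 4 * P ^ 2 :=
    mul_le_mul_of_nonneg_right (by nlinarith) (sq_nonneg P)
  have e2 : (1 + r) ^ 2 * Q ^ 2 ≤ 4 * Q ^ 2 :=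
    mul_le_mul_of_nonneg_right (by nlinarith) (sq_nonneg Q)
  linarith [sq_nonneg ((1 - r) * P + (1 + r) * Q)]

lemma sq_sub_le_two_mul (a b c : ℝ) : (a - c) ^ 2 ≤ 2 * (a - b) ^ 2 + 2 * (b - c) ^ 2 := by
  linarith [sq_nonneg ((a - b) - (b - c))]

/-- The TAP error is controlled by the four cavity quantities. -/
lemma sq_sub_tanh_le_tapBound {w : α → ℝ} (hw : ∀ s, 0 ≤ w s) (hw1 : ∑ s, w s = 1)
    (a : α → κ → ℝ) (q β h : ℝ) (x : κ → ℝ) {Z m X : ℝ}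
    (hZ : Z = ∑ s, w s * Real.cosh (β * (a s ⬝ᵥ x) + h))
    (hm : m * Z = ∑ s, w s * Real.sinh (β * (a s ⬝ᵥ x) + h))
    (hX : X * Z = ∑ s, w s * ((a s ⬝ᵥ x) * Real.cosh (β * (a s ⬝ᵥ x) + h))) :
    (m - Real.tanh (β * X + h - β ^ 2 * (1 - q) * m)) ^ 2 ≤ tapBound w a q β h x := by
  have hZ1 : 1 ≤ Z := by
    rw [hZ, ← hw1]
    exact Finset.sum_le_sum fun s _ => le_mul_of_one_le_right (hw s) (Real.one_le_cosh _)
  set L := bary w a ⬝ᵥ x with hL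
  set r := Real.tanh (β * L + h) with hr
  set P := Real.exp h * CavityData.expDiff w a q β x with hP
  set Q := Real.exp (-h) * CavityData.expDiff w a q (-β) x with hQ
  set U := Real.exp h * CavityData.tiltDiff w a q β x with hU
  set V := Real.exp (-h) * CavityData.tiltDiff w a q (-β) x with hV
  have hrabs := (Real.abs_tanh_lt_one (β * L + h)).le
  rw [← hr] at hrabs
  have hP' := exp_mul_expDiff hw1 a q β h x
  have hQ' := exp_mul_expDiff hw1 a q (-β) (-h) x
  rw [← hP] at hP'
  rw [← hQ] at hQ'
  have hbal : (1 - r) * Real.exp (β * L + h) = (1 + r) * Real.exp (-(β * L + h)) := by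
    have hc := Real.cosh_pos (β * L + h)
    have : r * Real.cosh (β * L + h) = Real.sinh (β * L + h) := by
      rw [hr, Real.tanh_eq_sinh_div_cosh]
      field_simp
    rw [Real.cosh_eq, Real.sinh_eq] at this
    linarith
  have hneg (t : ℝ) : -β * t + -h = -(β * t + h) := by ring
  have hcosh : Z = ((∑ s, w s * Real.exp (β * (a s ⬝ᵥ x) + h))
      + ∑ s, w s * Real.exp (-(β * (a s ⬝ᵥ x) + h))) / 2 := by
    rw [hZ, ← Finset.sum_add_distrib, Finset.sum_div]
    exact Finset.sum_congr rfl fun s _ => by rw [Real.cosh_eq]; ring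
  have hsinh : m * Z = ((∑ s, w s * Real.exp (β * (a s ⬝ᵥ x) + h))
      - ∑ s, w s * Real.exp (-(β * (a s ⬝ᵥ x) + h))) / 2 := by
    rw [hm, ← Finset.sum_sub_distrib, Finset.sum_div]
    exact Finset.sum_congr rfl fun s _ => by rw [Real.sinh_eq]; ring
  simp_rw [hneg] at hQ'
  rw [neg_sq] at hQ'
  have h1 : (m - r) * Z = ((1 - r) * P - (1 + r) * Q) / 2 := by
    rw [sub_mul, hsinh, hcosh, hP', hQ']
    linear_combination (Real.exp (β ^ 2 * (1 - q) / 2) / 2) * hbal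
  have h2 : (X - L - β * (1 - q) * m) * Z = (U + V) / 2 := by
    have hLZ : L * Z = ∑ s, w s * (L * Real.cosh (β * (a s ⬝ᵥ x) + h)) := by
      rw [hZ, Finset.mul_sum]
      exact Finset.sum_congr rfl fun s _ => by ring
    have e1 : (X - L - β * (1 - q) * m) * Z = X * Z - L * Z - β * (1 - q) * (m * Z) := by ring
    rw [e1, hX, hLZ, hm, hU, hV, CavityData.tiltDiff, CavityData.tiltDiff, Finset.mul_sum,
      Finset.mul_sum, Finset.mul_sum, ← Finset.sum_sub_distrib, ← Finset.sum_sub_distrib,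
      ← Finset.sum_add_distrib, Finset.sum_div]
    refine Finset.sum_congr rfl fun s _ => ?_
    rw [Real.cosh_eq, Real.sinh_eq, neg_add, Real.exp_add, Real.exp_add, ← neg_mul, ← hL]
    ring
  have absle : ∀ {u v : ℝ}, u * Z = v → u ^ 2 ≤ v ^ 2 := by
    rintro u v rfl
    rw [mul_pow]
    exact le_mul_of_one_le_right (sq_nonneg u) (one_le_pow₀ hZ1)
  have k1 : (m - r) ^ 2 ≤ 2 * (P ^ 2 + Q ^ 2) := (absle h1).trans (sq_half_sub_le hrabs)
  have k2 : (X - L - β * (1 - q) * m) ^ 2 ≤ (U ^ 2 + V ^ 2) / 2 :=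
    (absle h2).trans (by linarith [sq_nonneg (U - V)])
  have k3 : (r - Real.tanh (β * X + h - β ^ 2 * (1 - q) * m)) ^ 2
      ≤ β ^ 2 * (X - L - β * (1 - q) * m) ^ 2 := by
    rw [← mul_pow, ← sq_abs, ← sq_abs (β * _)]
    refine pow_le_pow_left₀ (abs_nonneg _) ((abs_tanh_sub_tanh_le _ _).trans (le_of_eq ?_)) 2
    rw [← abs_neg]
    congr 1
    ring
  have k4 := sq_sub_le_two_mul m r (Real.tanh (β * X + h - β ^ 2 * (1 - q) * m))
  have k5 := mul_le_mul_of_nonneg_left k2 (sq_nonneg β)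
  have sqexp (t : ℝ) : Real.exp t ^ 2 = Real.exp (2 * t) := by
    rw [← Real.exp_nat_mul]
    norm_num
  have e : tapBound w a q β h x = 4 * (P ^ 2 + Q ^ 2) + β ^ 2 * (U ^ 2 + V ^ 2) := by
    simp only [tapBound, hP, hQ, hU, hV, mul_pow, sqexp, mul_neg]
  rw [e]
  linarith

end PointwiseBound

section Cavity

variable {N : ℕ}

/-- The pair `p` involves the site `i`. -/
abbrev IsRow (i : Fin N) (p : Pairs N) : Prop := p.1.1 = i ∨ p.1.2 = i

/-- The pairs involving the site `i`. -/
abbrev Row (i : Fin N) := {p : Pairs N // IsRow i p}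

/-- The pairs not involving the site `i`. -/
abbrev CoRow (i : Fin N) := {p : Pairs N // ¬ IsRow i p}

lemma spin_mul_self (b : Bool) : spin b * spin b = 1 := by
  cases b <;> simp [spin]

lemma spin_not (b : Bool) : spin (!b) = -spin b := by
  cases b <;> simp [spin]

lemma sum_row (i : Fin N) {v : Fin N → Fin N → ℝ} (hv : ∀ j k, v j k = v k j) :
    ∑ p : Row i, v p.1.1.1 p.1.1.2 = ∑ j ∈ Finset.univ.erase i, v i j := by
  refine Finset.sum_bij' (fun p _ => if p.1.1.1 = i then p.1.1.2 else p.1.1.1)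
    (fun j hj => if hij : i < j then ⟨⟨(i, j), hij⟩, Or.inl rfl⟩
      else ⟨⟨(j, i), lt_of_le_of_ne (not_lt.1 hij) (Finset.ne_of_mem_erase hj)⟩, Or.inr rfl⟩)
    ?_ ?_ ?_ ?_ ?_
  · rintro ⟨⟨⟨j, k⟩, hjk⟩, hp⟩ _
    simp only [Finset.mem_erase, Finset.mem_univ, and_true]
    split_ifs with hj
    · exact fun hk => hjk.ne (hj.trans hk.symm)
    · exact hj
  · intro j hj
    exact Finset.mem_univ _
  · rintro ⟨⟨⟨j, k⟩, hjk⟩, hp⟩ _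
    simp only at hjk
    rcases hp with hp | hp
    · simp only at hp
      subst hp
      simp [hjk]
    · simp only at hp
      subst hp
      simp [hjk.ne, not_lt.2 hjk.le]
  · intro j hj
    have hji := Finset.ne_of_mem_erase hj
    by_cases hij : i < j
    · simp [hij]
    · simp [hij, hji]
  · rintro ⟨⟨⟨j, k⟩, hjk⟩, hp⟩ _
    simp only
    rcases hp with hp | hp
    · simp only at hp
      subst hp
      simp
    · simp only at hp
      subst hp
      simp only at hjk
      simp [hjk.ne, hv j k]

lemma gval_comm (G : Disorder N) (j k : Fin N) : gval G j k = gval G k j := by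
  unfold gval
  rcases lt_trichotomy j k with h | h | h
  · simp [h, h.not_gt]
  · simp [h]
  · simp [h, h.not_gt]

/-- The normalized spins seen by site `i`, indexed by the pairs involving `i`. -/
noncomputable def rowVec (i : Fin N) (σ : Config N) : Row i → ℝ :=
  fun p => spin (σ p.1.1.1) * spin (σ p.1.1.2) * spin (σ i) / Real.sqrt N

lemma rowVec_dotProduct_rowVec (i : Fin N) (σ τ : Config N) :
    rowVec i σ ⬝ᵥ rowVec i τ
      = overlap σ τ - spin (σ i) * spin (τ i) / N := by
  have h1 : rowVec i σ ⬝ᵥ rowVec i τ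
      = ∑ p : Row i, (fun j k => spin (σ j) * spin (σ k) * spin (σ i)
        * (spin (τ j) * spin (τ k) * spin (τ i)) / N) p.1.1.1 p.1.1.2 := by
    refine Finset.sum_congr rfl fun p _ => ?_
    simp only [rowVec]
    rw [div_mul_div_comm, Real.mul_self_sqrt (Nat.cast_nonneg N)]
  rw [h1, sum_row i (v := fun j k => spin (σ j) * spin (σ k) * spin (σ i)
        * (spin (τ j) * spin (τ k) * spin (τ i)) / N) (fun j k => by ring), overlap,
    ← Finset.add_sum_erase _ _ (Finset.mem_univ i),
    mul_add, Finset.mul_sum]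
  have h2 (j : Fin N) : spin (σ i) * spin (σ j) * spin (σ i)
      * (spin (τ i) * spin (τ j) * spin (τ i)) / N = 1 / N * (spin (σ j) * spin (τ j)) := by
    linear_combination (spin (σ j) * spin (τ j) / N * (spin (τ i) * spin (τ i)))
      * spin_mul_self (σ i) + (spin (σ j) * spin (τ j) / N) * spin_mul_self (τ i)
  simp_rw [h2]
  ring

lemma rowVec_dotProduct_self (hN : N ≠ 0) (i : Fin N) (σ : Config N) :
    rowVec i σ ⬝ᵥ rowVec i σ = 1 - 1 / N := by
  have : (N : ℝ) ≠ 0 := Nat.cast_ne_zero.2 hN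
  rw [rowVec_dotProduct_rowVec, overlap]
  simp_rw [spin_mul_self]
  simp [this]

lemma abs_dotProduct_le_of_self_le {κ : Type*} [Fintype κ] {u v : κ → ℝ} {c : ℝ}
    (hu : u ⬝ᵥ u ≤ c) (hv : v ⬝ᵥ v ≤ c) : |u ⬝ᵥ v| ≤ c := by
  have h1 : 0 ≤ (u - v) ⬝ᵥ (u - v) := Finset.sum_nonneg fun i _ => mul_self_nonneg _
  have h2 : 0 ≤ (u + v) ⬝ᵥ (u + v) := Finset.sum_nonneg fun i _ => mul_self_nonneg _
  simp only [sub_dotProduct, dotProduct_sub, add_dotProduct, dotProduct_add] at h1 h2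
  rw [dotProduct_comm v u] at h1 h2
  exact abs_le.2 ⟨by linarith, by linarith⟩

/-- The unnormalized cavity weight, in which site `i` is decoupled from the others. -/
noncomputable def cavWeight (β h : ℝ) (i : Fin N) (y : CoRow i → ℝ) (σ : Config N) : ℝ :=
  Real.exp ((β / Real.sqrt N) * ∑ p : CoRow i, y p * spin (σ p.1.1.1) * spin (σ p.1.1.2)
    + h * ∑ j ∈ Finset.univ.erase i, spin (σ j))

/-- The cavity probability. -/
noncomputable def cavProb (β h : ℝ) (i : Fin N) (y : CoRow i → ℝ) (σ : Config N) : ℝ :=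
  cavWeight β h i y σ / ∑ τ, cavWeight β h i y τ

lemma sum_cavWeight_pos (β h : ℝ) (i : Fin N) (y : CoRow i → ℝ) :
    0 < ∑ τ, cavWeight β h i y τ :=
  Finset.sum_pos (fun _ _ => Real.exp_pos _) Finset.univ_nonempty

lemma cavProb_nonneg (β h : ℝ) (i : Fin N) (y : CoRow i → ℝ) (σ : Config N) :
    0 ≤ cavProb β h i y σ :=
  div_nonneg (Real.exp_pos _).le (sum_cavWeight_pos β h i y).le

lemma sum_cavProb (β h : ℝ) (i : Fin N) (y : CoRow i → ℝ) : ∑ σ, cavProb β h i y σ = 1 := by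
  unfold cavProb
  rw [← Finset.sum_div, div_self (sum_cavWeight_pos β h i y).ne']

lemma cavityData (hN : N ≠ 0) (β h : ℝ) (i : Fin N) (y : CoRow i → ℝ) {q : ℝ} (hq : 0 ≤ q)
    (hq1 : q ≤ 1) : CavityData (cavProb β h i y) (rowVec i) q (1 / N) := by
  have hN' : (1 : ℝ) ≤ N := Nat.one_le_cast.2 (Nat.one_le_iff_ne_zero.2 hN)
  have h0 : (0 : ℝ) ≤ 1 / N := by positivity
  have hs (σ : Config N) : rowVec i σ ⬝ᵥ rowVec i σ ≤ 1 := by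
    rw [rowVec_dotProduct_self hN]
    linarith
  exact ⟨cavProb_nonneg β h i y, sum_cavProb β h i y, hq, hq1, h0,
    (div_le_one (by linarith)).2 hN', rowVec_dotProduct_self hN i,
    fun s t => abs_dotProduct_le_of_self_le (hs s) (hs t)⟩

/-- Flip the spin at site `i`. -/
def flip (i : Fin N) (σ : Config N) : Config N := Function.update σ i (!σ i)

lemma flip_involutive (i : Fin N) : Function.Involutive (flip (N := N) i) := by
  intro σ
  simp [flip]

lemma spin_flip_self (i : Fin N) (σ : Config N) : spin (flip i σ i) = -spin (σ i) := by
  simp [flip, spin_not]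

lemma flip_of_ne {i j : Fin N} (hj : j ≠ i) (σ : Config N) : flip i σ j = σ j := by
  simp [flip, hj]

lemma rowVec_flip (i : Fin N) (σ : Config N) : rowVec i (flip i σ) = rowVec i σ := by
  funext ⟨⟨⟨j, k⟩, hjk⟩, hp⟩
  simp only at hjk
  simp only [rowVec, spin_flip_self]
  rcases hp with hp | hp
  · simp only at hp
    subst hp
    rw [spin_flip_self, flip_of_ne hjk.ne']
    ring
  · simp only at hp
    subst hp
    rw [spin_flip_self, flip_of_ne hjk.ne]
    ring

lemma cavProb_flip (β h : ℝ) (i : Fin N) (y : CoRow i → ℝ) (σ : Config N) :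
    cavProb β h i y (flip i σ) = cavProb β h i y σ := by
  have : cavWeight β h i y (flip i σ) = cavWeight β h i y σ := by
    have h1 : ∑ p : CoRow i, y p * spin (flip i σ p.1.1.1) * spin (flip i σ p.1.1.2)
        = ∑ p : CoRow i, y p * spin (σ p.1.1.1) * spin (σ p.1.1.2) :=
      Finset.sum_congr rfl fun p _ => by
        rw [flip_of_ne fun e => p.2 (Or.inl e), flip_of_ne fun e => p.2 (Or.inr e)]
    have h2 : ∑ j ∈ Finset.univ.erase i, spin (flip i σ j)
        = ∑ j ∈ Finset.univ.erase i, spin (σ j) :=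
      Finset.sum_congr rfl fun j hj => by rw [flip_of_ne (Finset.ne_of_mem_erase hj)]
    simp only [cavWeight, h1, h2]
  rw [cavProb, cavProb, this]

lemma sum_mul_spin_eq_zero (i : Fin N) {u : Config N → ℝ} (hu : ∀ σ, u (flip i σ) = u σ) :
    ∑ σ, u σ * spin (σ i) = 0 := by
  have h := Equiv.sum_comp (flip_involutive i).toPerm (fun σ => u σ * spin (σ i))
  simp only [Function.Involutive.coe_toPerm, hu, spin_flip_self, mul_neg,
    Finset.sum_neg_distrib] at h
  linarith

lemma exp_spin_mul (b : Bool) (y : ℝ) :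
    Real.exp (spin b * y) = Real.cosh y + Real.sinh y * spin b := by
  cases b <;> simp [spin, Real.cosh_add_sinh, ← sub_eq_add_neg, Real.cosh_sub_sinh]

lemma sum_mul_exp_spin (i : Fin N) {u y : Config N → ℝ} (hu : ∀ σ, u (flip i σ) = u σ)
    (hy : ∀ σ, y (flip i σ) = y σ) :
    ∑ σ, u σ * Real.exp (spin (σ i) * y σ) = ∑ σ, u σ * Real.cosh (y σ) := by
  simp_rw [exp_spin_mul, mul_add, Finset.sum_add_distrib, ← mul_assoc]
  rw [sum_mul_spin_eq_zero i (u := fun σ => u σ * Real.sinh (y σ))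
    (fun σ => by simp only [hu, hy]), add_zero]

lemma sum_mul_spin_mul_exp_spin (i : Fin N) {u y : Config N → ℝ} (hu : ∀ σ, u (flip i σ) = u σ)
    (hy : ∀ σ, y (flip i σ) = y σ) :
    ∑ σ, u σ * (spin (σ i) * Real.exp (spin (σ i) * y σ)) = ∑ σ, u σ * Real.sinh (y σ) := by
  have h (σ : Config N) : u σ * (spin (σ i) * Real.exp (spin (σ i) * y σ))
      = u σ * Real.sinh (y σ) + (u σ * Real.cosh (y σ)) * spin (σ i) := by
    rw [exp_spin_mul]
    linear_combination (u σ * Real.sinh (y σ)) * spin_mul_self (σ i)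
  simp_rw [h]
  rw [Finset.sum_add_distrib, sum_mul_spin_eq_zero i (u := fun σ => u σ * Real.cosh (y σ))
    (fun σ => by simp only [hu, hy]), add_zero]

/-- The disorder coordinates involving the site `i`. -/
def rowPart (i : Fin N) (G : Disorder N) : Row i → ℝ := fun p => G p.1

/-- The disorder coordinates not involving the site `i`. -/
def coPart (i : Fin N) (G : Disorder N) : CoRow i → ℝ := fun p => G p.1

/-- The total field acting on the site `i`. -/
noncomputable def totField (β h : ℝ) (i : Fin N) (G : Disorder N) (σ : Config N) : ℝ :=
  β * (rowVec i σ ⬝ᵥ rowPart i G) + h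

/-- The cavity normalization. -/
noncomputable def cavZ (β h : ℝ) (i : Fin N) (G : Disorder N) : ℝ :=
  ∑ σ, cavProb β h i (coPart i G) σ * Real.cosh (totField β h i G σ)

lemma totField_flip (β h : ℝ) (i : Fin N) (G : Disorder N) (σ : Config N) :
    totField β h i G (flip i σ) = totField β h i G σ := by
  rw [totField, totField, rowVec_flip]

lemma ham_eq (β h : ℝ) (i : Fin N) (G : Disorder N) (σ : Config N) :
    Real.exp (ham β h G σ)
      = cavWeight β h i (coPart i G) σ * Real.exp (spin (σ i) * totField β h i G σ) := by
  rw [cavWeight, ← Real.exp_add, ham, ← Finset.add_sum_erase _ _ (Finset.mem_univ i),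
    ← Fintype.sum_subtype_add_sum_subtype (IsRow i)]
  congr 1
  have h1 : spin (σ i) * (β * (rowVec i σ ⬝ᵥ rowPart i G))
      = β / Real.sqrt N * ∑ p : Row i, G p.1 * spin (σ p.1.1.1) * spin (σ p.1.1.2) := by
    simp only [dotProduct, rowVec, rowPart, Finset.mul_sum]
    refine Finset.sum_congr rfl fun p _ => ?_
    linear_combination (β / Real.sqrt N * G p.1 * spin (σ p.1.1.1) * spin (σ p.1.1.2))
      * spin_mul_self (σ i)
  rw [totField, mul_add (spin (σ i)), h1]
  simp only [coPart]
  ring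

lemma one_le_cavZ (β h : ℝ) (i : Fin N) (G : Disorder N) : 1 ≤ cavZ β h i G := by
  rw [← sum_cavProb β h i (coPart i G)]
  exact Finset.sum_le_sum fun s _ =>
    le_mul_of_one_le_right (cavProb_nonneg β h i _ s) (Real.one_le_cosh _)

lemma gibbs_mul_cavZ (β h : ℝ) (i : Fin N) (G : Disorder N) (σ : Config N) :
    gibbs β h G σ * cavZ β h i G
      = cavProb β h i (coPart i G) σ * Real.exp (spin (σ i) * totField β h i G σ) := by
  have hW := sum_cavWeight_pos β h i (coPart i G)
  have hZ : Zpart β h G = (∑ τ, cavWeight β h i (coPart i G) τ) * cavZ β h i G := by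
    rw [cavZ, ← sum_mul_exp_spin i (cavProb_flip β h i _) (totField_flip β h i G), Zpart,
      Finset.mul_sum]
    refine Finset.sum_congr rfl fun τ _ => ?_
    rw [ham_eq β h i, cavProb]
    field_simp
  have h1 : cavZ β h i G ≠ 0 := by linarith [one_le_cavZ β h i G]
  rw [gibbs, hZ, ham_eq β h i, cavProb]
  field_simp

lemma qavg_mul_cavZ (β h : ℝ) (i : Fin N) (G : Disorder N) {u : Config N → ℝ}
    (hu : ∀ σ, u (flip i σ) = u σ) :
    qavg β h G u * cavZ β h i G
      = ∑ σ, cavProb β h i (coPart i G) σ * (u σ * Real.cosh (totField β h i G σ)) := by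
  rw [qavg, Finset.sum_mul]
  simp_rw [mul_assoc, gibbs_mul_cavZ, ← mul_assoc]
  rw [sum_mul_exp_spin i (fun σ => by rw [hu, cavProb_flip]) (totField_flip β h i G)]
  exact Finset.sum_congr rfl fun σ _ => by ring

lemma mavg_mul_cavZ (β h : ℝ) (i : Fin N) (G : Disorder N) :
    mavg β h G i * cavZ β h i G
      = ∑ σ, cavProb β h i (coPart i G) σ * Real.sinh (totField β h i G σ) := by
  rw [← sum_mul_spin_mul_exp_spin i (cavProb_flip β h i _) (totField_flip β h i G), mavg, qavg,
    Finset.sum_mul]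
  refine Finset.sum_congr rfl fun σ _ => ?_
  rw [mul_assoc, gibbs_mul_cavZ]
  ring

lemma sum_gval_mul_spin (i : Fin N) (G : Disorder N) (σ : Config N) :
    ∑ j ∈ Finset.univ.erase i, gval G i j * spin (σ j)
      = Real.sqrt N * (rowVec i σ ⬝ᵥ rowPart i G) := by
  have hN : Real.sqrt N ≠ 0 := by
    have : 0 < N := i.pos
    positivity
  have h1 : Real.sqrt N * (rowVec i σ ⬝ᵥ rowPart i G)
      = ∑ p : Row i, (fun j k => gval G j k * (spin (σ j) * spin (σ k) * spin (σ i)))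
        p.1.1.1 p.1.1.2 := by
    simp only [dotProduct, rowVec, rowPart, Finset.mul_sum]
    refine Finset.sum_congr rfl fun p _ => ?_
    have : gval G p.1.1.1 p.1.1.2 = G p.1 := by simp [gval, p.1.2]
    rw [this]
    field_simp
  rw [h1, sum_row i (v := fun j k => gval G j k * (spin (σ j) * spin (σ k) * spin (σ i)))
    (fun j k => by rw [gval_comm]; ring)]
  refine Finset.sum_congr rfl fun j _ => ?_
  linear_combination (-(gval G i j * spin (σ j))) * spin_mul_self (σ i)

lemma sum_gval_mul_mavg (β h : ℝ) (i : Fin N) (G : Disorder N) :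
    ∑ j ∈ Finset.univ.erase i, gval G i j * mavg β h G j
      = Real.sqrt N * qavg β h G (fun σ => rowVec i σ ⬝ᵥ rowPart i G) := by
  simp only [mavg, qavg, Finset.mul_sum]
  rw [Finset.sum_comm]
  refine Finset.sum_congr rfl fun σ _ => ?_
  rw [← mul_assoc, ← sum_gval_mul_spin, Finset.sum_mul]
  exact Finset.sum_congr rfl fun j _ => by ring

/-- The squared TAP error at site `i`. -/
noncomputable def tapError (β h q : ℝ) (i : Fin N) (G : Disorder N) : ℝ :=
  (mavg β h G i - Real.tanh ((β / Real.sqrt N)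
    * ∑ j ∈ Finset.univ.erase i, gval G i j * mavg β h G j
    + h - β ^ 2 * (1 - q) * mavg β h G i)) ^ 2

lemma tapError_le (β h q : ℝ) (i : Fin N) (G : Disorder N) :
    tapError β h q i G
      ≤ tapBound (cavProb β h i (coPart i G)) (rowVec i) q β h (rowPart i G) := by
  have hN : Real.sqrt N ≠ 0 := by
    have : 0 < N := i.pos
    positivity
  have hfield : β / Real.sqrt N * ∑ j ∈ Finset.univ.erase i, gval G i j * mavg β h G j
      = β * qavg β h G (fun σ => rowVec i σ ⬝ᵥ rowPart i G) := by
    rw [sum_gval_mul_mavg]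
    field_simp
  rw [tapError, hfield]
  exact sq_sub_tanh_le_tapBound (cavProb_nonneg β h i _) (sum_cavProb β h i _) _ q β h _
    (Z := cavZ β h i G) rfl (mavg_mul_cavZ β h i G)
    (qavg_mul_cavZ β h i G fun σ => by rw [rowVec_flip])

lemma gibbs_nonneg (β h : ℝ) (G : Disorder N) (σ : Config N) : 0 ≤ gibbs β h G σ :=
  div_nonneg (Real.exp_pos _).le (Finset.sum_nonneg fun _ _ => (Real.exp_pos _).le)

lemma sum_gibbs (β h : ℝ) (G : Disorder N) : ∑ σ, gibbs β h G σ = 1 := by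
  unfold gibbs
  rw [← Finset.sum_div]
  exact div_self (Finset.sum_pos (fun _ _ => Real.exp_pos _) Finset.univ_nonempty).ne'

lemma qavg2_mono (β h : ℝ) (G : Disorder N) {f g : Config N → Config N → ℝ}
    (hfg : ∀ s t, f s t ≤ g s t) : qavg2 β h G f ≤ qavg2 β h G g :=
  Finset.sum_le_sum fun s _ => Finset.sum_le_sum fun t _ =>
    mul_le_mul_of_nonneg_right
      (mul_le_mul_of_nonneg_right (hfg s t) (gibbs_nonneg β h G s)) (gibbs_nonneg β h G t)

lemma qavg2_mul_add (β h : ℝ) (G : Disorder N) (c d : ℝ) (f : Config N → Config N → ℝ) :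
    qavg2 β h G (fun s t => c * f s t + d) = c * qavg2 β h G f + d := by
  have h1 : ∑ s : Config N, ∑ t : Config N, d * gibbs β h G s * gibbs β h G t = d := by
    simp_rw [← Finset.mul_sum, sum_gibbs, mul_one, ← Finset.mul_sum, sum_gibbs, mul_one]
  simp only [qavg2, add_mul, Finset.sum_add_distrib, h1, Finset.mul_sum]
  refine congrArg (· + d) (Finset.sum_congr rfl fun s _ => Finset.sum_congr rfl fun t _ => ?_)
  ring

lemma dev_le_qavg2 (β h q : ℝ) (i : Fin N) (G : Disorder N) :
    dev (cavProb β h i (coPart i G)) (rowVec i) q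
      ≤ qavg2 β h G (fun s t => cavZ β h i G ^ 2 * |rowVec i s ⬝ᵥ rowVec i t - q|) := by
  set w := cavProb β h i (coPart i G)
  set y := totField β h i G
  have h1 (s : Config N) : ∑ t, |rowVec i s ⬝ᵥ rowVec i t - q| * w t * Real.exp (spin (t i) * y t)
      = ∑ t, |rowVec i s ⬝ᵥ rowVec i t - q| * w t * Real.cosh (y t) :=
    sum_mul_exp_spin i (fun t => by simp only [w, rowVec_flip, cavProb_flip])
      (totField_flip β h i G)
  have h2 : ∑ s, (∑ t, |rowVec i s ⬝ᵥ rowVec i t - q| * w t * Real.cosh (y t)) * w s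
        * Real.exp (spin (s i) * y s)
      = ∑ s, (∑ t, |rowVec i s ⬝ᵥ rowVec i t - q| * w t * Real.cosh (y t)) * w s
        * Real.cosh (y s) :=
    sum_mul_exp_spin i (fun t => by simp only [w, rowVec_flip, cavProb_flip])
      (totField_flip β h i G)
  have h3 : qavg2 β h G (fun s t => cavZ β h i G ^ 2 * |rowVec i s ⬝ᵥ rowVec i t - q|)
      = ∑ s, (∑ t, |rowVec i s ⬝ᵥ rowVec i t - q| * w t * Real.cosh (y t)) * w s
        * Real.cosh (y s) := by
    rw [← h2]
    simp_rw [← h1]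
    refine Finset.sum_congr rfl fun s _ => ?_
    rw [mul_assoc, ← gibbs_mul_cavZ, Finset.sum_mul]
    refine Finset.sum_congr rfl fun t _ => ?_
    rw [mul_assoc _ (w t), ← gibbs_mul_cavZ]
    ring
  rw [h3]
  refine Finset.sum_le_sum fun s _ => ?_
  rw [Finset.sum_mul, Finset.sum_mul]
  refine Finset.sum_le_sum fun t _ => ?_
  have p1 := Real.one_le_cosh (y s)
  have p2 := Real.one_le_cosh (y t)
  have p3 : 0 ≤ w s * w t * |rowVec i s ⬝ᵥ rowVec i t - q| :=
    mul_nonneg (mul_nonneg (cavProb_nonneg β h i _ s) (cavProb_nonneg β h i _ t)) (abs_nonneg _)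
  calc _ ≤ w s * w t * |rowVec i s ⬝ᵥ rowVec i t - q| * (Real.cosh (y s) * Real.cosh (y t)) :=
        le_mul_of_one_le_right p3 (one_le_mul_of_one_le_of_one_le p1 p2)
    _ = _ := by ring

lemma abs_spin (b : Bool) : |spin b| = 1 := by
  cases b <;> simp [spin]

lemma sq_mul_abs_sub_le {n r R q e Z : ℝ} (hn : 1 ≤ n) (hr : r = R - e / n ^ 2) (he : |e| ≤ 1) :
    Z ^ 2 * |r - q| ≤ n ^ 3 / 2 * (R - q) ^ 4 + (3 + Z ^ 4) / (2 * n) := by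
  have hn0 : 0 < n := by linarith
  have hn2 : 1 ≤ n ^ 2 := one_le_pow₀ hn
  have he2 : e ^ 2 ≤ 1 := (sq_le_one_iff_abs_le_one e).2 he
  have h1 : Z ^ 2 * |r - q| ≤ n / 2 * (r - q) ^ 2 + Z ^ 4 / (2 * n) := by
    have : n / 2 * (r - q) ^ 2 + Z ^ 4 / (2 * n) - Z ^ 2 * |r - q|
        = (n * |r - q| - Z ^ 2) ^ 2 / (2 * n) := by
      rw [← sq_abs (r - q)]
      field_simp
      ring
    have : 0 ≤ (n * |r - q| - Z ^ 2) ^ 2 / (2 * n) := by positivity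
    linarith
  have h2 : (r - q) ^ 2 ≤ 2 * (R - q) ^ 2 + 2 / n ^ 2 := by
    have e1 : (e / n ^ 2) ^ 2 ≤ 1 / n ^ 2 := by
      rw [div_pow, ← pow_mul, div_le_div_iff₀ (by positivity) (by positivity)]
      have : n ^ 2 ≤ n ^ (2 * 2) := pow_le_pow_right₀ hn (by norm_num)
      nlinarith
    have e2 : 2 / n ^ 2 = 2 * (1 / n ^ 2) := by ring
    rw [hr, e2]
    nlinarith [sq_nonneg (R - q + e / n ^ 2)]
  have h3 : 2 * (R - q) ^ 2 ≤ n ^ 2 * (R - q) ^ 4 + 1 / n ^ 2 := by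
    have : n ^ 2 * (R - q) ^ 4 + 1 / n ^ 2 - 2 * (R - q) ^ 2
        = (n ^ 2 * (R - q) ^ 2 - 1) ^ 2 / n ^ 2 := by
      field_simp
      ring
    have : 0 ≤ (n ^ 2 * (R - q) ^ 2 - 1) ^ 2 / n ^ 2 := by positivity
    linarith
  calc Z ^ 2 * |r - q| ≤ n / 2 * (n ^ 2 * (R - q) ^ 4 + 1 / n ^ 2 + 2 / n ^ 2)
          + Z ^ 4 / (2 * n) := by
        refine h1.trans (add_le_add_left (mul_le_mul_of_nonneg_left ?_ (by positivity)) _)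
        linarith
    _ = _ := by
        field_simp
        ring

/-- The fourth moment of the centered overlap. -/
noncomputable def overlapMoment (β h q : ℝ) (G : Disorder N) : ℝ :=
  qavg2 β h G (fun σ1 σ2 => (overlap σ1 σ2 - q) ^ 4)

lemma dev_le (β h : ℝ) {q : ℝ} (hq : 0 ≤ q) (hq1 : q ≤ 1) (i : Fin N) (G : Disorder N) :
    dev (cavProb β h i (coPart i G)) (rowVec i) q
      ≤ Real.sqrt N ^ 3 / 2 * overlapMoment β h q G
        + (3 + coshBound (cavProb β h i (coPart i G)) (rowVec i) β h (rowPart i G))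
          / (2 * Real.sqrt N) := by
  have hN : 0 < N := i.pos
  have hn : 1 ≤ Real.sqrt N := Real.one_le_sqrt.2 (Nat.one_le_cast.2 hN)
  have hZ : cavZ β h i G ^ 4
      ≤ coshBound (cavProb β h i (coPart i G)) (rowVec i) β h (rowPart i G) :=
    (cavityData hN.ne' β h i (coPart i G) hq hq1).sum_cosh_pow_four_le β h (rowPart i G)
  refine (dev_le_qavg2 β h q i G).trans ?_
  refine (qavg2_mono β h G (g := fun s t => Real.sqrt N ^ 3 / 2 * (overlap s t - q) ^ 4
    + (3 + cavZ β h i G ^ 4) / (2 * Real.sqrt N)) fun s t => ?_).trans ?_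
  · refine sq_mul_abs_sub_le hn (e := spin (s i) * spin (t i)) ?_ ?_
    · rw [Real.sq_sqrt (Nat.cast_nonneg N), rowVec_dotProduct_rowVec]
    · rw [abs_mul, abs_spin, abs_spin, one_mul]
  · rw [qavg2_mul_add, overlapMoment]
    gcongr

end Cavity

section Assembly

variable {N : ℕ}

lemma abs_mavg_le (β h : ℝ) (G : Disorder N) (i : Fin N) : |mavg β h G i| ≤ 1 := by
  rw [mavg, qavg, ← sum_gibbs β h G]
  refine (Finset.abs_sum_le_sum_abs _ _).trans (Finset.sum_le_sum fun σ _ => ?_)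
  rw [abs_mul, abs_spin, one_mul, abs_of_nonneg (gibbs_nonneg β h G σ)]

lemma tapError_nonneg (β h q : ℝ) (i : Fin N) (G : Disorder N) : 0 ≤ tapError β h q i G :=
  sq_nonneg _

lemma tapError_le_four (β h q : ℝ) (i : Fin N) (G : Disorder N) : tapError β h q i G ≤ 4 := by
  have h1 := abs_le.1 (abs_mavg_le β h G i)
  have h2 := abs_le.1 (Real.abs_tanh_lt_one ((β / Real.sqrt N)
    * ∑ j ∈ Finset.univ.erase i, gval G i j * mavg β h G j
    + h - β ^ 2 * (1 - q) * mavg β h G i)).le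
  rw [tapError, show (4 : ℝ) = 2 ^ 2 by norm_num]
  exact sq_le_sq' (by linarith) (by linarith)

lemma overlapMoment_nonneg (β h q : ℝ) (G : Disorder N) : 0 ≤ overlapMoment β h q G :=
  Finset.sum_nonneg fun s _ => Finset.sum_nonneg fun t _ =>
    mul_nonneg (mul_nonneg (by positivity) (gibbs_nonneg β h G s)) (gibbs_nonneg β h G t)

lemma abs_overlap_le (σ τ : Config N) : |overlap σ τ| ≤ 1 := by
  have h : |∑ i, spin (σ i) * spin (τ i)| ≤ N := by
    simpa [abs_mul, abs_spin] using
      Finset.abs_sum_le_sum_abs (fun i => spin (σ i) * spin (τ i)) Finset.univ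
  rw [overlap, abs_mul, abs_of_nonneg (by positivity), one_div_mul_eq_div]
  exact div_le_one_of_le₀ h (Nat.cast_nonneg N)

lemma overlapMoment_le {q : ℝ} (hq : 0 ≤ q) (hq1 : q ≤ 1) (β h : ℝ) (G : Disorder N) :
    overlapMoment β h q G ≤ 16 := by
  have h1 := qavg2_mul_add β h G 0 16 (fun _ _ => 0)
  simp only [mul_zero, zero_mul, zero_add] at h1
  rw [← h1]
  refine qavg2_mono β h G fun s t => ?_
  have h2 := abs_le.1 (abs_overlap_le s t)
  have h3 : |overlap s t - q| ≤ 2 := abs_le.2 ⟨by linarith, by linarith⟩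
  calc (overlap s t - q) ^ 4 = |overlap s t - q| ^ 4 := ((even_two_mul 2).pow_abs _).symm
    _ ≤ 2 ^ 4 := pow_le_pow_left₀ (abs_nonneg _) h3 4
    _ = 16 := by norm_num

lemma measurable_gibbs (β h : ℝ) (σ : Config N) :
    Measurable fun G : Disorder N => gibbs β h G σ := by
  unfold gibbs Zpart ham
  fun_prop

lemma measurable_mavg (β h : ℝ) (i : Fin N) :
    Measurable fun G : Disorder N => mavg β h G i := by
  unfold mavg qavg
  have := measurable_gibbs (N := N) β h
  fun_prop

lemma measurable_gval (i j : Fin N) : Measurable fun G : Disorder N => gval G i j := by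
  unfold gval
  split_ifs <;> fun_prop

lemma measurable_tanh : Measurable Real.tanh :=
  (continuous_iff_continuousAt.2 fun x => (hasDerivAt_tanh x).continuousAt).measurable

lemma measurable_tapError (β h q : ℝ) (i : Fin N) :
    Measurable (tapError β h q i) := by
  unfold tapError
  have h1 := measurable_mavg (N := N) β h
  have h2 := measurable_gval (N := N) i
  have h3 := measurable_tanh
  fun_prop

lemma measurable_overlapMoment (β h q : ℝ) : Measurable (overlapMoment (N := N) β h q) := by
  unfold overlapMoment qavg2
  have := measurable_gibbs (N := N) β h
  fun_prop

/-- Assemble a disorder from its coordinates involving and not involving the site `i`. -/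
def glue (i : Fin N) : (Row i → ℝ) × (CoRow i → ℝ) ≃ᵐ Disorder N :=
  (MeasurableEquiv.piEquivPiSubtypeProd (fun _ => ℝ) (IsRow i)).symm

lemma rowPart_glue (i : Fin N) (x : Row i → ℝ) (y : CoRow i → ℝ) :
    rowPart i (glue i (x, y)) = x :=
  congrArg Prod.fst ((glue i).symm_apply_apply (x, y))

lemma coPart_glue (i : Fin N) (x : Row i → ℝ) (y : CoRow i → ℝ) :
    coPart i (glue i (x, y)) = y :=
  congrArg Prod.snd ((glue i).symm_apply_apply (x, y))

lemma measurePreserving_glue (i : Fin N) :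
    MeasurePreserving (glue i) ((gaussPi (Row i)).prod (gaussPi (CoRow i))) (μdis N) :=
  (measurePreserving_piEquivPiSubtypeProd (fun _ => gaussianReal 0 1) (IsRow i)).symm

lemma integral_le_of_row_integral_le (i : Fin N) {Φ Ψ : Disorder N → ℝ}
    (hΦ : Integrable Φ (μdis N)) (hΨ : Integrable Ψ (μdis N))
    (hle : ∀ y, ∫ x, Φ (glue i (x, y)) ∂(gaussPi (Row i))
      ≤ ∫ x, Ψ (glue i (x, y)) ∂(gaussPi (Row i))) :
    ∫ G, Φ G ∂(μdis N) ≤ ∫ G, Ψ G ∂(μdis N) := by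
  have hm := measurePreserving_glue i
  have iΦ := (hm.integrable_comp_emb (glue i).measurableEmbedding).2 hΦ
  have iΨ := (hm.integrable_comp_emb (glue i).measurableEmbedding).2 hΨ
  rw [← hm.integral_comp', ← hm.integral_comp']
  change ∫ z, (Φ ∘ glue i) z ∂_ ≤ ∫ z, (Ψ ∘ glue i) z ∂_
  rw [integral_prod_symm _ iΦ, integral_prod_symm _ iΨ]
  exact integral_mono iΦ.integral_prod_right iΨ.integral_prod_right hle

/-- The bound on the fourth exponential moment of the cavity normalization. -/
noncomputable def coshConst (β h : ℝ) : ℝ :=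
  (Real.exp (4 * h) + Real.exp (-(4 * h))) * Real.exp (8 * β ^ 2)

lemma integrable_of_measurable_of_bounds {α : Type*} [MeasurableSpace α] {μ : Measure α}
    [IsFiniteMeasure μ] {f : α → ℝ} (hf : Measurable f) {c : ℝ} (h0 : ∀ x, 0 ≤ f x)
    (hc : ∀ x, f x ≤ c) : Integrable f μ :=
  Integrable.of_bound hf.aestronglyMeasurable c
    (Filter.Eventually.of_forall fun x => by rw [Real.norm_of_nonneg (h0 x)]; exact hc x)

lemma integral_glue_tapError_le (β h : ℝ) {q : ℝ} (hq : 0 ≤ q) (hq1 : q ≤ 1) (i : Fin N)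
    (y : CoRow i → ℝ) :
    ∫ x, tapError β h q i (glue i (x, y)) ∂(gaussPi (Row i))
      ≤ ∫ x, (tapConst β h * (Real.sqrt N ^ 3 / 2) * overlapMoment β h q (glue i (x, y))
        + tapConst β h * ((5 + coshConst β h) / (2 * Real.sqrt N))) ∂(gaussPi (Row i)) := by
  have hN : 0 < N := i.pos
  have hN1 : (1 : ℝ) ≤ N := Nat.one_le_cast.2 hN
  have hn : 1 ≤ Real.sqrt N := Real.one_le_sqrt.2 hN1
  have hsq : Real.sqrt N ^ 2 = N := Real.sq_sqrt (Nat.cast_nonneg N)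
  have hg : Measurable fun x : Row i → ℝ => glue i (x, y) :=
    (glue i).measurable.comp measurable_prodMk_right
  have iT : Integrable (fun x => tapError β h q i (glue i (x, y))) (gaussPi (Row i)) :=
    integrable_of_measurable_of_bounds ((measurable_tapError β h q i).comp hg)
      (fun _ => tapError_nonneg ..) (fun _ => tapError_le_four ..)
  have iM : Integrable (fun x => overlapMoment β h q (glue i (x, y))) (gaussPi (Row i)) :=
    integrable_of_measurable_of_bounds ((measurable_overlapMoment β h q).comp hg)
      (fun _ => overlapMoment_nonneg ..) (fun _ => overlapMoment_le hq hq1 ..)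
  have H := cavityData hN.ne' β h i y hq hq1
  set w := cavProb β h i y
  have h1 : ∫ x, tapError β h q i (glue i (x, y)) ∂(gaussPi (Row i))
      ≤ tapConst β h * (dev w (rowVec i) q + 1 / N) := by
    refine le_trans (integral_mono iT (integrable_tapBound w (rowVec i) q β h) fun x => ?_)
      (H.integral_tapBound_le β h)
    have := tapError_le β h q i (glue i (x, y))
    rwa [rowPart_glue, coPart_glue] at this
  have iC := integrable_coshBound w (rowVec i) β h
  have i1 : Integrable (fun x => Real.sqrt N ^ 3 / 2 * overlapMoment β h q (glue i (x, y)))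
    (gaussPi (Row i)) := iM.const_mul _
  have i2 : Integrable (fun x => (3 + coshBound w (rowVec i) β h x) / (2 * Real.sqrt N))
    (gaussPi (Row i)) := ((integrable_const 3).add iC).div_const _
  have h2 : dev w (rowVec i) q
      ≤ Real.sqrt N ^ 3 / 2 * ∫ x, overlapMoment β h q (glue i (x, y)) ∂(gaussPi (Row i))
        + (3 + coshConst β h) / (2 * Real.sqrt N) := by
    calc dev w (rowVec i) q = ∫ _, dev w (rowVec i) q ∂(gaussPi (Row i)) := by simp
      _ ≤ ∫ x, (Real.sqrt N ^ 3 / 2 * overlapMoment β h q (glue i (x, y))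
            + (3 + coshBound w (rowVec i) β h x) / (2 * Real.sqrt N)) ∂(gaussPi (Row i)) := by
          refine integral_mono (integrable_const _) (i1.add i2) fun x => ?_
          have := dev_le β h hq hq1 i (glue i (x, y))
          rwa [rowPart_glue, coPart_glue] at this
      _ = Real.sqrt N ^ 3 / 2 * ∫ x, overlapMoment β h q (glue i (x, y)) ∂(gaussPi (Row i))
            + (3 + ∫ x, coshBound w (rowVec i) β h x ∂(gaussPi (Row i)))
              / (2 * Real.sqrt N) := by
          rw [integral_add i1 i2, integral_const_mul, integral_div,
            integral_add (integrable_const 3) iC]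
          simp
      _ ≤ _ := by
          gcongr
          exact H.integral_coshBound_le β h
  have h3 : 1 / (N : ℝ) ≤ 2 / (2 * Real.sqrt N) := by
    rw [show 2 / (2 * Real.sqrt N) = 1 / Real.sqrt N by field_simp]
    exact one_div_le_one_div_of_le (by linarith) (by nlinarith)
  rw [integral_add (iM.const_mul _) (integrable_const _), integral_const_mul]
  simp only [integral_const, probReal_univ, one_smul]
  refine h1.trans ?_
  calc _ ≤ tapConst β h * (Real.sqrt N ^ 3 / 2
          * ∫ x, overlapMoment β h q (glue i (x, y)) ∂(gaussPi (Row i))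
        + (3 + coshConst β h) / (2 * Real.sqrt N) + 2 / (2 * Real.sqrt N)) :=
        mul_le_mul_of_nonneg_left (add_le_add h2 h3) (tapConst_nonneg β h)
    _ = _ := by ring

instance isProbabilityMeasure_μdis : IsProbabilityMeasure (μdis N) := by
  unfold μdis
  infer_instance

lemma integral_tapError_le (β h : ℝ) {q K : ℝ} (hq : 0 ≤ q) (hq1 : q ≤ 1) (i : Fin N)
    (hK : highTemp N β h q K) :
    ∫ G, tapError β h q i G ∂(μdis N)
      ≤ tapConst β h * (K + 5 + coshConst β h) / 2 / Real.sqrt N := by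
  have iM : Integrable (overlapMoment β h q) (μdis N) :=
    integrable_of_measurable_of_bounds (measurable_overlapMoment β h q)
      (overlapMoment_nonneg β h q) (overlapMoment_le hq hq1 β h)
  have iT : Integrable (tapError β h q i) (μdis N) :=
    integrable_of_measurable_of_bounds (measurable_tapError β h q i)
      (tapError_nonneg β h q i) (tapError_le_four β h q i)
  have i1 : Integrable (fun G => tapConst β h * (Real.sqrt N ^ 3 / 2) * overlapMoment β h q G)
    (μdis N) := iM.const_mul _
  refine (integral_le_of_row_integral_le i iT (i1.add (integrable_const _))
    (integral_glue_tapError_le β h hq hq1 i)).trans ?_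
  simp only [Pi.add_apply]
  rw [integral_add i1 (integrable_const _), integral_const_mul]
  simp only [integral_const, probReal_univ, one_smul]
  have hn : 0 < Real.sqrt N := Real.sqrt_pos.2 (Nat.cast_pos.2 i.pos)
  have h1 : ∫ G, overlapMoment β h q G ∂(μdis N) ≤ K / Real.sqrt N ^ 4 := by
    have : (N : ℝ) ^ 2 = Real.sqrt N ^ 4 := by
      rw [show (4 : ℕ) = 2 * 2 by norm_num, pow_mul, Real.sq_sqrt (Nat.cast_nonneg N)]
    rw [← this]
    exact hK
  have hT := tapConst_nonneg β h
  calc _ ≤ tapConst β h * (Real.sqrt N ^ 3 / 2) * (K / Real.sqrt N ^ 4)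
        + tapConst β h * ((5 + coshConst β h) / (2 * Real.sqrt N)) := by gcongr
    _ = _ := by
      field_simp
      ring

end Assembly

/-- The Thouless-Anderson-Palmer equations, with quantitative error bound. -/
theorem tap_equations (β h K : ℝ) (hβ : 0 < β) (hK : 0 < K) :
    ∃ C : ℝ, 0 < C ∧ ∀ (N : ℕ) (q : ℝ), 2 ≤ N → 0 ≤ q → q < 1 →
      highTemp N β h q K →
      ∀ i : Fin N,
        ∫ G, (mavg β h G i
            - Real.tanh ((β / Real.sqrt N)
                * ∑ j ∈ Finset.univ.erase i, gval G i j * mavg β h G j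
                + h - β ^ 2 * (1 - q) * mavg β h G i)) ^ 2 ∂(μdis N)
        ≤ C / Real.sqrt N := by
  refine ⟨|tapConst β h * (K + 5 + coshConst β h) / 2| + 1, by positivity, ?_⟩
  intro N q _ hq hq1 hT i
  refine (integral_tapError_le β h hq hq1.le i hT).trans ?_
  gcongr
  exact (le_abs_self _).trans (by linarith)

end SK
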